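/- arXiv:1607.06177 — 4 statements merged into one kernel-verified Lean document; each statement's English description precedes it below -/
import Mathlib

section
/- Let V be a C¹ vector field on a connected open set 𝒰 ⊆ ℝⁿ and let Ω ⊆ 𝒰 be an open set whose closure is compact and contained in 𝒰, which is positively invariant under V, i.e. V generates a positive semiflow φ : [0,∞) × Ω → Ω. Then a Borel probability measure μ on Ω is a positively invariant measure of φ (μ(φ(t,·)⁻¹(B)) = μ(B) for every Borel B ⊆ Ω and every t ≥ 0) if and only if ∫_Ω V(x)·∇h(x) dμ(x) = 0 for every C¹ function h : Ω → ℝ such that h and its first partial derivatives are bounded on Ω. -/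
open MeasureTheory Set Filter Topology

noncomputable section

/-- Euclidean `n`-space. -/
abbrev En (n : ℕ) := EuclideanSpace ℝ (Fin n)

/-- The positive semiflow generated by `V` on a positively invariant set `Ω`. -/
def IsSemiflowOn {n : ℕ} (V : En n → En n) (Ω : Set (En n)) (φ : ℝ → En n → En n) : Prop :=
  ContinuousOn (fun p : ℝ × En n => φ p.1 p.2) (Ici (0 : ℝ) ×ˢ Ω) ∧
  (∀ t : ℝ, 0 ≤ t → ∀ x ∈ Ω, φ t x ∈ Ω) ∧
  (∀ x ∈ Ω, φ 0 x = x) ∧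
  (∀ t s : ℝ, 0 ≤ t → 0 ≤ s → ∀ x ∈ Ω, φ (t + s) x = φ t (φ s x)) ∧
  (∀ x ∈ Ω, ∀ t : ℝ, 0 ≤ t →
    HasDerivWithinAt (fun τ => φ τ x) (V (φ t x)) (Ici 0) t)
/-- A Borel probability measure concentrated on `Ω`. -/
def IsProbOn {n : ℕ} (Ω : Set (En n)) (μ : Measure (En n)) : Prop :=
  IsProbabilityMeasure μ ∧ μ Ωᶜ = 0
/-- `μ` is a positively invariant measure of the semiflow `φ` on `Ω`:
`μ(φ(t,·)⁻¹(B)) = μ(B)` for every Borel `B ⊆ Ω` and every `t ≥ 0`. -/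
def IsPosInvariantUnder {n : ℕ} (Ω : Set (En n)) (φ : ℝ → En n → En n)
    (μ : Measure (En n)) : Prop :=
  ∀ t : ℝ, 0 ≤ t → ∀ B : Set (En n), B ⊆ Ω → MeasurableSet B → μ (Ω ∩ φ t ⁻¹' B) = μ B

lemma moll_bound {n : ℕ} (ρ : ContDiffBump (0 : En n)) (h : En n → ℝ) (hh : Continuous h)
    (a b : En n) (c B : ℝ)
    (hB : ∀ y ∈ Metric.ball (0 : En n) ρ.rOut, |h (a - y) - h (b - y) - c| ≤ B) :
    |(∫ y, ρ.normed volume y * h (a - y)) - (∫ y, ρ.normed volume y * h (b - y)) - c| ≤ B := by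
  have hint : ∀ f : En n → ℝ, Continuous f →
      Integrable (fun y => ρ.normed volume y * f y) volume := by
    intro f hf
    apply Continuous.integrable_of_hasCompactSupport
    · exact ρ.continuous_normed.mul hf
    · exact ρ.hasCompactSupport_normed.mul_right
  have e : (∫ y, ρ.normed volume y * h (a - y)) - (∫ y, ρ.normed volume y * h (b - y)) - c
      = ∫ y, ρ.normed volume y * (h (a - y) - h (b - y) - c) := by
    have e1 : c = ∫ y, ρ.normed (volume : Measure (En n)) y * c := by
      rw [integral_mul_const, ρ.integral_normed, one_mul]
    conv_lhs => rw [e1]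
    rw [← integral_sub, ← integral_sub]
    · congr 1; ext y; ring
    · exact (hint _ (by fun_prop)).sub (hint _ (by fun_prop))
    · exact hint _ (by fun_prop)
    · exact hint _ (by fun_prop)
    · exact hint _ (by fun_prop)
  rw [e, ← Real.norm_eq_abs]
  have : B = ∫ y, ρ.normed (volume : Measure (En n)) y * B := by
    rw [integral_mul_const, ρ.integral_normed, one_mul]
  rw [this]
  apply norm_integral_le_of_norm_le (hint _ continuous_const)
  filter_upwards with y
  rw [norm_mul, Real.norm_eq_abs, Real.norm_eq_abs, abs_of_nonneg (ρ.nonneg_normed y)]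
  by_cases hy : y ∈ Metric.ball (0 : En n) ρ.rOut
  · exact mul_le_mul_of_nonneg_left (hB y hy) (ρ.nonneg_normed y)
  · have : ρ.normed (volume : Measure (En n)) y = 0 := by
      rw [← ρ.support_normed_eq (μ := volume)] at hy
      simpa using hy
    simp [this]

lemma mollify {n : ℕ} (h : En n → ℝ) (K : NNReal) (hh : LipschitzWith K h) :
    ∃ H : ℕ → En n → ℝ, (∀ k, ContDiff ℝ 1 (H k)) ∧ (∀ k, LipschitzWith K (H k)) ∧
      ∀ (x v : En n) (d : ℝ),
        (∀ η > 0, ∃ δ > 0, ∀ z ∈ Metric.ball x δ, ∀ s ∈ Ioo 0 δ,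
          |h (z + s • v) - h z - s * d| ≤ η * s) →
        Tendsto (fun k => fderiv ℝ (H k) x v) atTop (𝓝 d) := by
  let ρ : ℕ → ContDiffBump (0 : En n) := fun k =>
    ⟨1 / (2 * ((k : ℝ) + 1)), 1 / ((k : ℝ) + 1), by positivity, by
      apply one_div_lt_one_div_of_lt <;> linarith [(Nat.cast_nonneg k : (0 : ℝ) ≤ k)]⟩
  have hρ : ∀ k, (ρ k).rOut = 1 / ((k : ℝ) + 1) := fun k => rfl
  refine ⟨fun k x => ∫ y, (ρ k).normed volume y * h (x - y), ?_, ?_, ?_⟩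
  · intro k
    have := ((ρ k).hasCompactSupport_normed (μ := volume)).contDiff_convolution_left
      (𝕜 := ℝ) (n := 1) (ContinuousLinearMap.mul ℝ ℝ) (ρ k).contDiff_normed
      (hh.continuous.locallyIntegrable (μ := volume))
    exact this
  · intro k
    apply LipschitzWith.of_dist_le_mul
    intro a b
    have := moll_bound (ρ k) h hh.continuous a b 0 (K * dist a b) (by
      intro y hy
      have := hh.dist_le_mul (a - y) (b - y)
      simpa [Real.dist_eq] using this)
    simpa [Real.dist_eq] using this
  · intro x v d hs
    rw [Metric.tendsto_atTop]
    intro ε hε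
    obtain ⟨δ, hδ, H⟩ := hs (ε / 2) (by positivity)
    obtain ⟨N, hN⟩ := exists_nat_one_div_lt hδ
    refine ⟨N, fun k hk => ?_⟩
    have hkd : (ρ k).rOut < δ := by
      rw [hρ]
      refine lt_of_le_of_lt ?_ hN
      apply one_div_le_one_div_of_le (by positivity)
      have : (N : ℝ) ≤ k := by exact_mod_cast hk
      linarith
    set F : En n → ℝ := fun x => ∫ y, (ρ k).normed volume y * h (x - y) with hF
    have hcd : ContDiff ℝ 1 F := ((ρ k).hasCompactSupport_normed (μ := volume)).contDiff_convolution_left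
      (𝕜 := ℝ) (n := 1) (ContinuousLinearMap.mul ℝ ℝ) (ρ k).contDiff_normed
      (hh.continuous.locallyIntegrable (μ := volume))
    have hd : HasFDerivAt F (fderiv ℝ F x) x :=
      (hcd.differentiable (by simp) x).hasFDerivAt
    have hl := (hd.hasLineDerivAt v).tendsto_slope_zero_right
    have : |fderiv ℝ F x v - d| ≤ ε / 2 := by
      have h2 : Tendsto (fun t : ℝ => |t⁻¹ • (F (x + t • v) - F x) - d|) (𝓝[>] 0)
          (𝓝 |fderiv ℝ F x v - d|) := by
        have := (hl.sub_const d).abs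
        simpa using this
      apply le_of_tendsto h2
      filter_upwards [Ioo_mem_nhdsGT hδ] with s hs
      have := moll_bound (ρ k) h hh.continuous (x + s • v) x (s * d) (ε / 2 * s) (by
        intro y hy
        have := H (x - y) (by
          simp only [Metric.mem_ball, dist_zero_right, dist_self_sub_left] at hy ⊢
          linarith) s hs
        rw [show x + s • v - y = x - y + s • v by abel]
        exact this)
      have e : s⁻¹ • (F (x + s • v) - F x) - d = s⁻¹ * (F (x + s • v) - F x - s * d) := by
        have := hs.1.ne'
        simp only [smul_eq_mul]
        field_simp
      rw [e, abs_mul, abs_of_pos (inv_pos.2 hs.1), inv_mul_le_iff₀ hs.1]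
      rw [mul_comm s (ε / 2)]; exact this
    rw [Real.dist_eq]
    linarith

lemma c1_lip {n : ℕ} {F : Type*} [NormedAddCommGroup F] [NormedSpace ℝ F] (f : En n → F)
    (U S : Set (En n)) (hU : IsOpen U) (hf : ContDiffOn ℝ 1 f U) (hS : IsCompact S) (hSU : S ⊆ U) :
    ∃ K : NNReal, LipschitzOnWith K f S := by
  apply LocallyLipschitzOn.exists_lipschitzOnWith_of_compact hS
  intro x hx
  obtain ⟨K, t, ht, hK⟩ :=
    (hf.contDiffAt (hU.mem_nhds (hSU hx))).exists_lipschitzOnWith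
  exact ⟨K, t, mem_nhdsWithin_of_mem_nhds ht, hK⟩

lemma chain_flow {n : ℕ} {Ω : Set (En n)} (hΩ : IsOpen Ω) {V : En n → En n}
    {φ : ℝ → En n → En n} (hφ : IsSemiflowOn V Ω φ) {g : En n → ℝ} (hg : ContDiffOn ℝ 1 g Ω)
    {x : En n} (hx : x ∈ Ω) {t : ℝ} (ht : 0 ≤ t) :
    HasDerivWithinAt (fun τ => g (φ τ x)) (fderiv ℝ g (φ t x) (V (φ t x))) (Ici 0) t := by
  have h1 : HasFDerivAt g (fderiv ℝ g (φ t x)) (φ t x) :=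
    ((hg.contDiffAt (hΩ.mem_nhds (hφ.2.1 t ht x hx))).differentiableAt (by simp)).hasFDerivAt
  exact h1.comp_hasDerivWithinAt t (hφ.2.2.2.2 x hx t ht)

lemma dcont {n : ℕ} {Ω : Set (En n)} (hΩ : IsOpen Ω) {V : En n → En n} (hV : ContinuousOn V Ω)
    {g : En n → ℝ} (hg : ContDiffOn ℝ 1 g Ω) :
    ContinuousOn (fun x => fderiv ℝ g x (V x)) Ω :=
  (hg.continuousOn_fderiv_of_isOpen hΩ (by simp)).clm_apply hV

lemma flow_cont {n : ℕ} {Ω : Set (En n)} {V : En n → En n}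
    {φ : ℝ → En n → En n} (hφ : IsSemiflowOn V Ω φ) {t : ℝ} (ht : 0 ≤ t) :
    ContinuousOn (φ t) Ω := by
  have : ContinuousOn (fun x : En n => ((t, x) : ℝ × En n)) Ω := by fun_prop
  exact hφ.1.comp this (fun x hx => ⟨ht, hx⟩)

lemma strict_dir {n : ℕ} {Ω : Set (En n)} (hΩ : IsOpen Ω) {V : En n → En n}
    (hV : ContinuousOn V Ω)
    {φ : ℝ → En n → En n} (hφ : IsSemiflowOn V Ω φ) {h d : En n → ℝ} {K : NNReal}
    (hh : LipschitzWith K h) (hd : ContinuousOn d Ω)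
    (hdh : ∀ x ∈ Ω, ∀ t, 0 ≤ t → HasDerivWithinAt (fun τ => h (φ τ x)) (d (φ t x)) (Ici 0) t)
    {x : En n} (hx : x ∈ Ω) :
    ∀ η > 0, ∃ δ > 0, ∀ z ∈ Metric.ball x δ, ∀ s ∈ Ioo 0 δ,
          |h (z + s • V x) - h z - s * d x| ≤ η * s := by
  intro η hη
  have hmaps : MapsTo (fun p : ℝ × En n => φ p.1 p.2) (Ici (0 : ℝ) ×ˢ Ω) Ω :=
    fun p hp => hφ.2.1 p.1 hp.1 p.2 hp.2
  have hmem : ((0 : ℝ), x) ∈ Ici (0 : ℝ) ×ˢ Ω := ⟨by simp, hx⟩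
  have c1 := (hV.comp hφ.1 hmaps) _ hmem
  have c2 := (hd.comp hφ.1 hmaps) _ hmem
  rw [Metric.continuousWithinAt_iff] at c1 c2
  obtain ⟨δ1, hδ1, H1⟩ := c1 (η / (2 * (K + 1))) (by positivity)
  obtain ⟨δ2, hδ2, H2⟩ := c2 (η / 2) (by positivity)
  obtain ⟨δ3, hδ3, H3⟩ := Metric.isOpen_iff.1 hΩ x hx
  simp only [Function.comp, hφ.2.2.1 x hx] at H1 H2
  refine ⟨min δ1 (min δ2 δ3), by positivity, fun z hz s hs => ?_⟩
  obtain ⟨hs0, hs1⟩ := hs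
  rw [Metric.mem_ball] at hz
  simp only [lt_min_iff] at hz hs1
  have hzΩ : z ∈ Ω := H3 hz.2.2
  have hIci : ∀ τ ∈ Ico (0 : ℝ) s, Ici τ ⊆ Ici (0 : ℝ) := fun τ hτ => Ici_subset_Ici.2 hτ.1
  have hcφ : ContinuousOn (fun τ => φ τ z) (Icc 0 s) := fun τ hτ =>
    ((hφ.2.2.2.2 z hzΩ τ hτ.1).continuousWithinAt).mono Icc_subset_Ici_self
  have hch : ContinuousOn (fun τ => h (φ τ z)) (Icc 0 s) := hh.continuous.comp_continuousOn hcφ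
  have B1 := norm_image_sub_le_of_norm_deriv_right_le_segment
    (f := fun τ => φ τ z - τ • V x) (f' := fun τ => V (φ τ z) - V x) (a := 0) (b := s)
    (C := η / (2 * (K + 1)))
    (hcφ.sub (by fun_prop)) (by
      intro τ hτ
      have e := ((hφ.2.2.2.2 z hzΩ τ hτ.1).mono (hIci τ hτ))
      have e2 := ((hasDerivAt_id τ).smul_const (V x)).hasDerivWithinAt (s := Ici τ)
      have := e.sub e2
      rw [one_smul] at this
      exact this) (by
      intro τ hτ
      rw [← dist_eq_norm]
      refine (H1 (x := (τ, z)) ⟨hτ.1, hzΩ⟩ ?_).le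
      rw [Prod.dist_eq, max_lt_iff]
      refine ⟨?_, hz.1⟩
      simp only [Real.dist_eq, sub_zero, abs_of_nonneg hτ.1]
      linarith [hτ.2]) s ⟨hs0.le, le_rfl⟩
  have B2 := norm_image_sub_le_of_norm_deriv_right_le_segment
    (f := fun τ => h (φ τ z) - τ • d x) (f' := fun τ => d (φ τ z) - d x) (a := 0) (b := s)
    (C := η / 2)
    (hch.sub (by fun_prop)) (by
      intro τ hτ
      have e := ((hdh z hzΩ τ hτ.1).mono (hIci τ hτ))
      have e2 := ((hasDerivAt_id τ).smul_const (d x)).hasDerivWithinAt (s := Ici τ)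
      have := e.sub e2
      rw [one_smul] at this
      exact this) (by
      intro τ hτ
      rw [← dist_eq_norm]
      refine (H2 (x := (τ, z)) ⟨hτ.1, hzΩ⟩ ?_).le
      rw [Prod.dist_eq, max_lt_iff]
      refine ⟨?_, hz.2.1⟩
      simp only [Real.dist_eq, sub_zero, abs_of_nonneg hτ.1]
      linarith [hτ.2]) s ⟨hs0.le, le_rfl⟩
  simp only [hφ.2.2.1 z hzΩ, zero_smul, zero_mul, sub_zero, smul_eq_mul, Real.norm_eq_abs] at B1 B2
  have B3 := hh.dist_le_mul (z + s • V x) (φ s z)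
  rw [Real.dist_eq, dist_comm, dist_eq_norm, show φ s z - (z + s • V x) = φ s z - s • V x - z by abel] at B3
  have B4 : (K : ℝ) * (η / (2 * (K + 1)) * s) ≤ η / 2 * s := by
    have : (K : ℝ) * (η / (2 * (K + 1))) ≤ η / 2 := by
      rw [mul_div_assoc', div_le_div_iff₀ (by positivity) (by positivity)]
      nlinarith
    nlinarith
  have B5 := B3.trans ((mul_le_mul_of_nonneg_left B1 K.2).trans B4)
  calc |h (z + s • V x) - h z - s * d x|
      = |(h (z + s • V x) - h (φ s z)) + (h (φ s z) - s * d x - h z)| := by congr 1; ring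
    _ ≤ _ := abs_add_le _ _
    _ ≤ η * s := by linarith

lemma integral_zero {n : ℕ} {Ω : Set (En n)} (hΩ : IsOpen Ω) (hcl : IsCompact (closure Ω))
    {V : En n → En n} (hV : ContinuousOn V Ω) {M : ℝ} (hM : ∀ x ∈ Ω, ‖V x‖ ≤ M)
    {φ : ℝ → En n → En n} (hφ : IsSemiflowOn V Ω φ) {h d : En n → ℝ} {K : NNReal}
    (hh : LipschitzOnWith K h Ω) (hd : ContinuousOn d Ω)
    (hdh : ∀ x ∈ Ω, ∀ t, 0 ≤ t → HasDerivWithinAt (fun τ => h (φ τ x)) (d (φ t x)) (Ici 0) t)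
    (μ : Measure (En n)) [IsProbabilityMeasure μ]
    (H : ∀ h : En n → ℝ, ContDiffOn ℝ 1 h Ω →
        (∃ C, ∀ x ∈ Ω, |h x| ≤ C ∧ ‖fderiv ℝ h x‖ ≤ C) →
        ∫ x in Ω, fderiv ℝ h x (V x) ∂μ = 0) :
    ∫ x in Ω, d x ∂μ = 0 := by
  obtain ⟨h', hh', heq⟩ := hh.extend_real
  have hdh' : ∀ x ∈ Ω, ∀ t, 0 ≤ t →
      HasDerivWithinAt (fun τ => h' (φ τ x)) (d (φ t x)) (Ici 0) t := by
    intro x hx t ht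
    refine (hdh x hx t ht).congr (fun τ hτ => ?_) ?_
    · exact (heq (hφ.2.1 τ hτ x hx)).symm
    · exact (heq (hφ.2.1 t ht x hx)).symm
  obtain ⟨F, F1, F2, F3⟩ := mollify h' K hh'
  have hz : ∀ k, ∫ x in Ω, fderiv ℝ (F k) x (V x) ∂μ = 0 := by
    intro k
    apply H _ (F1 k).contDiffOn
    obtain ⟨C, hC⟩ := hcl.exists_bound_of_continuousOn (F1 k).continuous.continuousOn
    refine ⟨max C K, fun x hx => ⟨?_, ?_⟩⟩
    · exact (hC x (subset_closure hx)).trans (le_max_left _ _)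
    · exact (norm_fderiv_le_of_lipschitz ℝ (F2 k)).trans (le_max_right _ _)
  have := tendsto_integral_of_dominated_convergence (μ := μ.restrict Ω)
    (F := fun k x => fderiv ℝ (F k) x (V x)) (f := d) (fun _ => K * M)
    (fun k => (dcont hΩ hV (F1 k).contDiffOn).aestronglyMeasurable hΩ.measurableSet)
    (integrable_const _)
    (fun k => (ae_restrict_iff' hΩ.measurableSet).2 (Eventually.of_forall fun x hx => by
      refine (ContinuousLinearMap.le_opNorm _ _).trans ?_
      exact mul_le_mul (norm_fderiv_le_of_lipschitz ℝ (F2 k)) (hM x hx) (norm_nonneg _) K.2))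
    ((ae_restrict_iff' hΩ.measurableSet).2 (Eventually.of_forall fun x hx =>
      F3 x (V x) (d x) (strict_dir hΩ hV hφ hh' hd hdh' hx)))
  simp only [hz] at this
  exact tendsto_nhds_unique this tendsto_const_nhds

lemma deriv_int {n : ℕ} {Ω : Set (En n)} (hΩ : IsOpen Ω)
    {V : En n → En n} (hV : ContinuousOn V Ω) {M : ℝ} (hM : ∀ x ∈ Ω, ‖V x‖ ≤ M)
    {φ : ℝ → En n → En n} (hφ : IsSemiflowOn V Ω φ) {g : En n → ℝ} (hg : ContDiffOn ℝ 1 g Ω)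
    {C : ℝ} (hC : ∀ x ∈ Ω, |g x| ≤ C ∧ ‖fderiv ℝ g x‖ ≤ C)
    (μ : Measure (En n)) [IsProbabilityMeasure μ] {t : ℝ} (ht : 0 ≤ t) :
    HasDerivWithinAt (fun τ => ∫ x in Ω, g (φ τ x) ∂μ)
      (∫ x in Ω, fderiv ℝ g (φ t x) (V (φ t x)) ∂μ) (Ici t) t := by
  have hms : ∀ {τ : ℝ}, 0 ≤ τ → AEStronglyMeasurable (fun x => g (φ τ x)) (μ.restrict Ω) :=
    fun {τ} hτ => (hg.continuousOn.comp (flow_cont hφ hτ) (fun x hx => hφ.2.1 τ hτ x hx)).aestronglyMeasurable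
      hΩ.measurableSet
  have hint : ∀ {τ : ℝ}, 0 ≤ τ → Integrable (fun x => g (φ τ x)) (μ.restrict Ω) := by
    intro τ hτ
    refine Integrable.of_bound (hms hτ) C ?_
    exact (ae_restrict_iff' hΩ.measurableSet).2 (Eventually.of_forall fun x hx =>
      (hC _ (hφ.2.1 τ hτ x hx)).1)
  rw [← hasDerivWithinAt_Ioi_iff_Ici, hasDerivWithinAt_iff_tendsto_slope' (by simp)]
  have key := tendsto_integral_filter_of_dominated_convergence (μ := μ.restrict Ω) (l := 𝓝[>] t)
    (F := fun τ x => slope (fun τ => g (φ τ x)) t τ)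
    (f := fun x => fderiv ℝ g (φ t x) (V (φ t x))) (fun _ => C * M) ?_ ?_ (integrable_const _) ?_
  · refine key.congr' ?_
    filter_upwards [self_mem_nhdsWithin] with τ hτ
    have hτ0 : 0 ≤ τ := ht.trans (le_of_lt hτ)
    simp only [slope, vsub_eq_sub]
    rw [integral_smul, integral_sub (hint hτ0) (hint ht)]
  · filter_upwards [self_mem_nhdsWithin] with τ hτ
    have hτ0 : 0 ≤ τ := ht.trans (le_of_lt hτ)
    simp only [slope, vsub_eq_sub]
    exact ((hms hτ0).sub (hms ht)).const_smul (τ - t)⁻¹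
  · filter_upwards [self_mem_nhdsWithin] with τ hτ
    have hτ' : t < τ := hτ
    refine (ae_restrict_iff' hΩ.measurableSet).2 (Eventually.of_forall fun x hx => ?_)
    have hder : ∀ s ∈ Ici t, HasDerivWithinAt (fun τ => g (φ τ x))
      (fderiv ℝ g (φ s x) (V (φ s x))) (Ici t) s := fun s hs =>
      (chain_flow hΩ hφ hg hx (ht.trans hs)).mono (Ici_subset_Ici.2 ht)
    have := norm_image_sub_le_of_norm_deriv_right_le_segment
      (f := fun τ => g (φ τ x)) (f' := fun s => fderiv ℝ g (φ s x) (V (φ s x))) (a := t) (b := τ)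
      (C := C * M) (fun s hs => (hder s hs.1).continuousWithinAt.mono Icc_subset_Ici_self)
      (fun s hs => (hder s hs.1).mono (Ici_subset_Ici.2 hs.1)) (fun s hs => by
        have hm := hφ.2.1 s (ht.trans hs.1) x hx
        refine (ContinuousLinearMap.le_opNorm _ _).trans ?_
        exact mul_le_mul (hC _ hm).2 (hM _ hm) (norm_nonneg _) ((abs_nonneg _).trans (hC _ hm).1))
      τ ⟨hτ'.le, le_rfl⟩
    have hp : 0 < τ - t := sub_pos.2 hτ'
    simp only [slope, vsub_eq_sub, norm_smul, norm_inv]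
    rw [Real.norm_of_nonneg hp.le, inv_mul_le_iff₀ hp, mul_comm (τ - t)]
    exact this
  · refine (ae_restrict_iff' hΩ.measurableSet).2 (Eventually.of_forall fun x hx => ?_)
    have := ((chain_flow hΩ hφ hg hx ht).mono (Ici_subset_Ici.2 ht))
    rwa [← hasDerivWithinAt_Ioi_iff_Ici, hasDerivWithinAt_iff_tendsto_slope' (by simp)] at this

lemma inv_iff {n : ℕ} {Ω : Set (En n)} (hΩ : IsOpen Ω) {V : En n → En n}
    {φ : ℝ → En n → En n} (hφ : IsSemiflowOn V Ω φ) (μ : Measure (En n)) :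
    IsPosInvariantUnder Ω φ μ ↔
      ∀ t : ℝ, 0 ≤ t → (μ.restrict Ω).map (φ t) = μ.restrict Ω := by
  have hae : ∀ t, 0 ≤ t → AEMeasurable (φ t) (μ.restrict Ω) := fun t ht =>
    (flow_cont hφ ht).aemeasurable hΩ.measurableSet
  constructor
  · intro h t ht
    ext B hB
    rw [Measure.map_apply_of_aemeasurable (hae t ht) hB, Measure.restrict_apply' hΩ.measurableSet,
      Measure.restrict_apply' hΩ.measurableSet, ← h t ht (B ∩ Ω) inter_subset_right
        (hB.inter hΩ.measurableSet)]
    congr 1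
    ext x
    simp only [mem_inter_iff, mem_preimage]
    have := hφ.2.1 t ht x
    tauto
  · intro h t ht B hBΩ hB
    have : (μ.restrict Ω).map (φ t) B = μ.restrict Ω B := by rw [h t ht]
    rw [Measure.map_apply_of_aemeasurable (hae t ht) hB, Measure.restrict_apply' hΩ.measurableSet,
      Measure.restrict_apply' hΩ.measurableSet, inter_eq_left.2 hBΩ] at this
    rw [inter_comm, this]

lemma ext_smooth {n : ℕ} (μ ν : Measure (En n)) [IsFiniteMeasure μ] [IsFiniteMeasure ν]
    (H : ∀ g : En n → ℝ, ContDiff ℝ 1 g → (∀ x, |g x| ≤ 1) → ∫ x, g x ∂μ = ∫ x, g x ∂ν) :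
    μ = ν := by
  have hreal : ∀ U : Set (En n), IsOpen U → μ U = ν U := by
    intro U hU
    obtain ⟨f, hsupp, hf, hr⟩ := hU.exists_contDiff_support_eq (n := 1)
    have hf01 : ∀ x, 0 ≤ f x ∧ f x ≤ 1 := fun x => hr ⟨x, rfl⟩
    have hfc : Continuous f := hf.continuous
    have hb : ∀ (k : ℕ) x, |1 - (1 - f x) ^ k| ≤ 1 := by
      intro k x
      have h1 := pow_nonneg (sub_nonneg.2 (hf01 x).2) k
      have h2 := pow_le_one₀ (n := k) (sub_nonneg.2 (hf01 x).2) (by linarith [(hf01 x).1])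
      rw [abs_le]; constructor <;> linarith
    have hlim : ∀ (m : Measure (En n)) [IsFiniteMeasure m],
        Tendsto (fun k : ℕ => ∫ x, (1 - (1 - f x) ^ k) ∂m) atTop (𝓝 (m.real U)) := by
      intro m _
      have : m.real U = ∫ x, U.indicator (fun _ => (1 : ℝ)) x ∂m := by
        rw [integral_indicator_const _ hU.measurableSet]; simp
      rw [this]
      apply tendsto_integral_of_dominated_convergence (fun _ => (1 : ℝ))
      · intro k
        exact Continuous.aestronglyMeasurable (by fun_prop)
      · exact integrable_const _
      · intro k
        exact Eventually.of_forall (hb k)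
      · refine Eventually.of_forall fun x => ?_
        by_cases hx : x ∈ U
        · rw [indicator_of_mem hx]
          have hne : f x ≠ 0 := by rw [← hsupp] at hx; exact hx
          have hpos : 0 < f x := lt_of_le_of_ne (hf01 x).1 (Ne.symm hne)
          have := (tendsto_pow_atTop_nhds_zero_of_lt_one (sub_nonneg.2 (hf01 x).2)
            (by linarith : 1 - f x < 1)).const_sub 1
          simpa using this
        · rw [indicator_of_notMem hx]
          have : f x = 0 := by
            rw [← hsupp] at hx
            simpa using hx
          simp [this]
    have he : μ.real U = ν.real U := by
      refine tendsto_nhds_unique (hlim μ) ((hlim ν).congr fun k => ?_)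
      refine (H _ ?_ (hb k)).symm
      exact contDiff_const.sub ((contDiff_const.sub hf).pow k)
    exact (measureReal_eq_measureReal_iff).1 he
  refine ext_of_generate_finite {s | IsOpen s} BorelSpace.measurable_eq isPiSystem_isOpen
    (fun s hs => hreal s hs) (hreal _ isOpen_univ)

theorem stmt1 {n : ℕ} (hn : 1 ≤ n) (𝒰 Ω : Set (En n))
    (h𝒰open : IsOpen 𝒰) (h𝒰conn : IsConnected 𝒰)
    (V : En n → En n) (hV : ContDiffOn ℝ 1 V 𝒰)
    (hΩopen : IsOpen Ω) (hΩcl : IsCompact (closure Ω)) (hΩ𝒰 : closure Ω ⊆ 𝒰)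
    (φ : ℝ → En n → En n) (hφ : IsSemiflowOn V Ω φ)
    (μ : Measure (En n)) (hμ : IsProbOn Ω μ) :
    IsPosInvariantUnder Ω φ μ ↔
      ∀ h : En n → ℝ, ContDiffOn ℝ 1 h Ω →
        (∃ C, ∀ x ∈ Ω, |h x| ≤ C ∧ ‖fderiv ℝ h x‖ ≤ C) →
        ∫ x in Ω, fderiv ℝ h x (V x) ∂μ = 0 := by
  have := hμ.1
  have hVc : ContinuousOn V Ω := hV.continuousOn.mono (subset_closure.trans hΩ𝒰)
  obtain ⟨M, hM'⟩ := hΩcl.exists_bound_of_continuousOn (hV.continuousOn.mono hΩ𝒰)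
  have hM : ∀ x ∈ Ω, ‖V x‖ ≤ M := fun x hx => hM' x (subset_closure hx)
  have hae : ∀ t, 0 ≤ t → AEMeasurable (φ t) (μ.restrict Ω) := fun t ht =>
    (flow_cont hφ ht).aemeasurable hΩopen.measurableSet
  rw [inv_iff hΩopen hφ]
  constructor
  · rintro hinv h hh ⟨C, hC⟩
    have h1 := deriv_int hΩopen hVc hM hφ hh hC μ le_rfl
    have h2 : HasDerivWithinAt (fun τ => ∫ x in Ω, h (φ τ x) ∂μ) 0 (Ici 0) 0 := by
      refine (hasDerivWithinAt_const (0 : ℝ) (Ici 0) (∫ x in Ω, h x ∂μ)).congr_of_mem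
        (fun τ hτ => ?_) (by simp)
      have hm : AEStronglyMeasurable h ((μ.restrict Ω).map (φ τ)) := by
        rw [hinv τ hτ]
        exact hh.continuousOn.aestronglyMeasurable hΩopen.measurableSet
      rw [← integral_map (hae τ hτ) hm, hinv τ hτ]
    have h3 := (uniqueDiffOn_Ici (0 : ℝ) 0 (by simp)).eq_deriv _ h1 h2
    rw [← h3]
    refine setIntegral_congr_fun hΩopen.measurableSet fun x hx => ?_
    simp only [hφ.2.2.1 x hx]
  · intro H T hT
    apply ext_smooth
    intro g hg hg1
    rw [integral_map (hae T hT) hg.continuous.aestronglyMeasurable]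
    obtain ⟨Kv, hKv⟩ := c1_lip V 𝒰 _ h𝒰open hV hΩcl hΩ𝒰
    obtain ⟨Kg, hKg⟩ := c1_lip g univ _ isOpen_univ hg.contDiffOn hΩcl (subset_univ _)
    obtain ⟨C, hC⟩ := hΩcl.exists_bound_of_continuousOn
      (hg.continuous_fderiv (by simp)).continuousOn
    have hCg : ∀ x ∈ Ω, |g x| ≤ max 1 C ∧ ‖fderiv ℝ g x‖ ≤ max 1 C := fun x hx =>
      ⟨(hg1 x).trans (le_max_left _ _), (hC x (subset_closure hx)).trans (le_max_right _ _)⟩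
    have hder : ∀ t, 0 ≤ t → HasDerivWithinAt (fun τ => ∫ x in Ω, g (φ τ x) ∂μ) 0 (Ici t) t := by
      intro t ht
      have h1 := deriv_int hΩopen hVc hM hφ hg.contDiffOn hCg μ ht
      have h2 : ∫ x in Ω, fderiv ℝ g (φ t x) (V (φ t x)) ∂μ = 0 := by
        have hmt : MapsTo (φ t) Ω Ω := fun x hx => hφ.2.1 t ht x hx
        have hlip : LipschitzOnWith (Real.toNNReal (Real.exp (Kv * (t - 0)))) (φ t) Ω := by
          apply LipschitzOnWith.of_dist_le_mul
          intro x hx y hy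
          have hcφ : ∀ z ∈ Ω, ContinuousOn (fun τ => φ τ z) (Icc 0 t) := fun z hz τ hτ =>
            ((hφ.2.2.2.2 z hz τ hτ.1).continuousWithinAt).mono Icc_subset_Ici_self
          have := dist_le_of_trajectories_ODE_of_mem (v := fun _ => V) (s := fun _ => Ω)
            (K := Kv) (f := fun τ => φ τ x) (g := fun τ => φ τ y) (a := 0) (b := t)
            (δ := dist x y)
            (fun _ _ => hKv.mono subset_closure) (hcφ x hx)
            (fun τ hτ => (hφ.2.2.2.2 x hx τ hτ.1).mono (Ici_subset_Ici.2 hτ.1))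
            (fun τ hτ => hφ.2.1 τ hτ.1 x hx) (hcφ y hy)
            (fun τ hτ => (hφ.2.2.2.2 y hy τ hτ.1).mono (Ici_subset_Ici.2 hτ.1))
            (fun τ hτ => hφ.2.1 τ hτ.1 y hy) (by rw [hφ.2.2.1 x hx, hφ.2.2.1 y hy])
            t ⟨ht, le_rfl⟩
          rw [Real.coe_toNNReal _ (Real.exp_pos _).le, mul_comm]
          exact this
        refine integral_zero hΩopen hΩcl hVc hM hφ (h := fun x => g (φ t x))
          ((hKg.mono subset_closure).comp hlip hmt)
          ((dcont hΩopen hVc hg.contDiffOn).comp (flow_cont hφ ht) hmt) ?_ μ H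
        intro x hx s hs
        have := chain_flow hΩopen hφ hg.contDiffOn (hmt hx) hs
        have e : ∀ τ, 0 ≤ τ → φ t (φ τ x) = φ τ (φ t x) := by
          intro τ hτ
          rw [← hφ.2.2.2.1 t τ ht hτ x hx, add_comm, hφ.2.2.2.1 τ t hτ ht x hx]
        change HasDerivWithinAt (fun τ => g (φ t (φ τ x)))
          (fderiv ℝ g (φ t (φ s x)) (V (φ t (φ s x)))) (Ici 0) s
        rw [e s hs]
        refine this.congr (fun τ hτ => ?_) ?_
        · simp only [e τ hτ]
        · simp only [e s hs]
      rwa [h2] at h1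
    have := constant_of_has_deriv_right_zero (f := fun τ => ∫ x in Ω, g (φ τ x) ∂μ) (a := 0)
      (b := T) (fun τ hτ => ?_) (fun τ hτ => hder τ hτ.1) T ⟨hT, le_rfl⟩
    · rw [this]
      refine setIntegral_congr_fun hΩopen.measurableSet fun x hx => ?_
      simp only [hφ.2.2.1 x hx]
    · have hcont : ContinuousOn (fun τ => ∫ x in Ω, g (φ τ x) ∂μ) (Ici 0) := by
        apply continuousOn_of_dominated (bound := fun _ => (1 : ℝ))
        · intro s hs
          exact (hg.continuous.comp_continuousOn (flow_cont hφ hs)).aestronglyMeasurable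
            hΩopen.measurableSet
        · exact fun s hs => Eventually.of_forall fun x => hg1 _
        · exact integrable_const _
        · refine (ae_restrict_iff' hΩopen.measurableSet).2 (Eventually.of_forall fun x hx => ?_)
          exact hg.continuous.comp_continuousOn
            (fun s hs => (hφ.2.2.2.2 x hx s hs).continuousWithinAt)
      exact (hcont.mono Icc_subset_Ici_self) τ hτ

end
end

section
/- Let Ω ⊆ 𝒰 be a connected open set, let (A_k) be a null sequence of diffusion matrices on 𝒰, and for each k let μ_k be a Borel probability measure on Ω that is a stationary measure for ℒ_{A_k} on Ω. If μ_k converges weak* to a Borel probability measure μ on Ω, then ∫_Ω V(x)·∇h(x) dμ(x) = 0 for every C¹ function h : ℝⁿ → ℝ whose (compact) support is contained in Ω. -/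
open MeasureTheory Set Filter Topology

noncomputable section

/-- The adjoint Fokker–Planck operator
`ℒ_A f(x) = ∑ᵢⱼ aⁱʲ(x) ∂²f/∂xᵢ∂xⱼ(x) + ∑ᵢ Vⁱ(x) ∂f/∂xᵢ(x)`. -/
noncomputable def adjFP {n : ℕ} (A : En n → Matrix (Fin n) (Fin n) ℝ) (V : En n → En n)
    (f : En n → ℝ) (x : En n) : ℝ :=
  (∑ i, ∑ j, A x i j *
      iteratedFDeriv ℝ 2 f x ![EuclideanSpace.single i (1 : ℝ), EuclideanSpace.single j (1 : ℝ)])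
    + fderiv ℝ f x (V x)
/-- `μ` is a stationary measure for `ℒ_A` on `Ω`: it is a Borel probability measure on `Ω`
and `∫_Ω ℒ_A f dμ = 0` for every smooth `f` with compact support contained in `Ω`. -/
def IsStationaryMeasure {n : ℕ} (A : En n → Matrix (Fin n) (Fin n) ℝ) (V : En n → En n)
    (Ω : Set (En n)) (μ : Measure (En n)) : Prop :=
  IsProbOn Ω μ ∧
  ∀ f : En n → ℝ, ContDiff ℝ (⊤ : ℕ∞) f → HasCompactSupport f → tsupport f ⊆ Ω →
    ∫ x in Ω, adjFP A V f x ∂μ = 0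
/-- A null sequence of diffusion matrices on `𝒰`: continuous maps into the symmetric
positive-definite matrices converging to `0` uniformly on every compact subset of `𝒰`. -/
def IsNullSeq {n : ℕ} (𝒰 : Set (En n)) (A : ℕ → En n → Matrix (Fin n) (Fin n) ℝ) : Prop :=
  (∀ k, ContinuousOn (A k) 𝒰) ∧
  (∀ k, ∀ x ∈ 𝒰, (A k x).PosDef) ∧
  (∀ K : Set (En n), K ⊆ 𝒰 → IsCompact K →
    ∀ ε > 0, ∃ N, ∀ k ≥ N, ∀ x ∈ K, ∀ i j, |A k x i j| ≤ ε)
/-- Weak* convergence `μs → μ` of Borel probability measures on `Ω`: the integrals of every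
bounded continuous function on `Ω` converge. -/
def WeakStarLimOn {n : ℕ} (Ω : Set (En n)) (μs : ℕ → Measure (En n))
    (μ : Measure (En n)) : Prop :=
  ∀ f : En n → ℝ, ContinuousOn f Ω → (∃ C, ∀ x ∈ Ω, |f x| ≤ C) →
    Tendsto (fun k => ∫ x in Ω, f x ∂μs k) atTop (𝓝 (∫ x in Ω, f x ∂μ))

theorem aux_bdd {n : ℕ} {Ω K : Set (En n)} (hK : IsCompact K) (hKΩ : K ⊆ Ω) {g : En n → ℝ}
    (hg : ContinuousOn g Ω) (h0 : ∀ x, x ∉ K → g x = 0) : ∃ C, 0 ≤ C ∧ ∀ x, |g x| ≤ C := by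
  obtain ⟨C, hC⟩ := hK.exists_bound_of_continuousOn (hg.mono hKΩ)
  refine ⟨max C 0, le_max_right _ _, fun x => ?_⟩
  by_cases hx : x ∈ K
  · exact (hC x hx).trans (le_max_left _ _)
  · rw [h0 x hx]; simp

theorem aux_int {n : ℕ} {Ω K : Set (En n)} (hΩ : IsOpen Ω) (hK : IsCompact K) (hKΩ : K ⊆ Ω)
    {g : En n → ℝ} (hg : ContinuousOn g Ω) (h0 : ∀ x, x ∉ K → g x = 0)
    (μ : Measure (En n)) [IsFiniteMeasure μ] : IntegrableOn g Ω μ := by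
  obtain ⟨C, -, hC⟩ := aux_bdd hK hKΩ hg h0
  exact Integrable.of_bound (hg.aestronglyMeasurable hΩ.measurableSet) C
    (Eventually.of_forall hC)

theorem aux_approx {n : ℕ} {h : En n → ℝ} (hh : ContDiff ℝ 1 h) (hc : HasCompactSupport h)
    {δ ε : ℝ} (hδ : 0 < δ) (hε : 0 < ε) :
    ∃ f : En n → ℝ, ContDiff ℝ (⊤ : ℕ∞) f ∧ tsupport f ⊆ Metric.cthickening δ (tsupport h) ∧
      ∀ x, ‖fderiv ℝ f x - fderiv ℝ h x‖ ≤ ε := by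
  have hcont : Continuous (fderiv ℝ h) := hh.continuous_fderiv one_ne_zero
  have huc := (hc.fderiv ℝ).uniformContinuous_of_continuous hcont
  obtain ⟨r, hr, hru⟩ := Metric.uniformContinuous_iff.1 huc ε hε
  have hm : 0 < min r δ := lt_min hr hδ
  let φ : ContDiffBump (0 : En n) := ⟨min r δ / 2, min r δ, by linarith, by linarith⟩
  have hφ : φ.rOut = min r δ := rfl
  refine ⟨convolution (φ.normed volume) h (ContinuousLinearMap.lsmul ℝ ℝ) volume, ?_, ?_, ?_⟩
  · exact φ.hasCompactSupport_normed.contDiff_convolution_left _ φ.contDiff_normed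
      hh.continuous.locallyIntegrable
  · refine closure_minimal ?_ Metric.isClosed_cthickening
    refine (support_convolution_subset _).trans ?_
    rw [φ.support_normed_eq]
    rintro _ ⟨a, ha, b, hb, rfl⟩
    refine Metric.mem_cthickening_of_dist_le _ b _ _ (subset_tsupport _ hb) ?_
    have : ‖a‖ < min r δ := by simpa [hφ] using ha
    simpa [dist_eq_norm] using this.le.trans (min_le_right _ _)
  · intro x
    have h1 := hc.hasFDerivAt_convolution_right (μ := volume) (ContinuousLinearMap.lsmul ℝ ℝ)
      (f := φ.normed volume) φ.continuous_normed.locallyIntegrable hh x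
    rw [h1.fderiv, ← dist_eq_norm]
    have h2 := φ.dist_normed_convolution_le (μ := volume) (g := fderiv ℝ h) (x₀ := x) (ε := ε)
      hcont.aestronglyMeasurable
      (fun y hy => (hru (lt_of_lt_of_le hy (min_le_left _ _))).le)
    exact h2

theorem aux_smooth {n : ℕ} (𝒰 Ω : Set (En n))
    (V : En n → En n) (hV : ContinuousOn V 𝒰)
    (hΩopen : IsOpen Ω) (hΩ𝒰 : Ω ⊆ 𝒰)
    (A : ℕ → En n → Matrix (Fin n) (Fin n) ℝ) (hA : IsNullSeq 𝒰 A)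
    (μs : ℕ → Measure (En n)) (hμs : ∀ k, IsStationaryMeasure (A k) V Ω (μs k))
    (μ : Measure (En n)) (hlim : WeakStarLimOn Ω μs μ)
    (f : En n → ℝ) (hf : ContDiff ℝ (⊤ : ℕ∞) f) (hc : HasCompactSupport f)
    (hs : tsupport f ⊆ Ω) : ∫ x in Ω, fderiv ℝ f x (V x) ∂μ = 0 := by
  have hVΩ := hV.mono hΩ𝒰
  have hg : ContinuousOn (fun x => fderiv ℝ f x (V x)) Ω :=
    (hf.continuous_fderiv (by simp)).continuousOn.clm_apply hVΩ
  have hg0 : ∀ x, x ∉ tsupport f → fderiv ℝ f x (V x) = 0 := by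
    intro x hx
    have : fderiv ℝ f x = 0 := by
      by_contra h
      exact hx (support_fderiv_subset ℝ h)
    simp [this]
  obtain ⟨C, hC0, hC⟩ := aux_bdd hc hs hg hg0
  have ht := hlim _ hg ⟨C, fun x _ => hC x⟩
  refine tendsto_nhds_unique ht ?_
  -- second order part
  let D : Fin n → Fin n → En n → ℝ := fun i j x =>
    iteratedFDeriv ℝ 2 f x ![EuclideanSpace.single i (1 : ℝ), EuclideanSpace.single j (1 : ℝ)]
  have hD : ∀ i j, Continuous (D i j) := fun i j =>
    (ContinuousMultilinearMap.apply ℝ (fun _ : Fin 2 => En n) ℝ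
      ![EuclideanSpace.single i (1 : ℝ), EuclideanSpace.single j (1 : ℝ)]).continuous.comp
      (hf.continuous_iteratedFDeriv (m := 2) (WithTop.coe_le_coe.2 (le_top : (2 : ℕ∞) ≤ ⊤)))
  have hD0 : ∀ i j x, x ∉ tsupport f → D i j x = 0 := by
    intro i j x hx
    have : iteratedFDeriv ℝ 2 f x = 0 := by
      by_contra h
      exact hx (support_iteratedFDeriv_subset 2 h)
    simp [D, this]
  choose B hB0 hB using fun i j => aux_bdd hc hs (hD i j).continuousOn (hD0 i j)
  let S : ℕ → En n → ℝ := fun k x => ∑ i, ∑ j, A k x i j * D i j x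
  have hS : ∀ k, ContinuousOn (S k) Ω := by
    intro k
    refine continuousOn_finsetSum _ fun i _ => continuousOn_finsetSum _ fun j _ => ?_
    have hAk : ContinuousOn (A k) Ω := (hA.1 k).mono hΩ𝒰
    exact ((continuous_apply_apply i j).comp_continuousOn hAk).mul (hD i j).continuousOn
  have hS0 : ∀ k x, x ∉ tsupport f → S k x = 0 := by
    intro k x hx
    simp [S, hD0 _ _ x hx]
  have hkey : ∀ k, ∫ x in Ω, fderiv ℝ f x (V x) ∂μs k = - ∫ x in Ω, S k x ∂μs k := by
    intro k
    have := (hμs k).1.1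
    have h1 := (hμs k).2 f hf hc hs
    have h2 := integral_add (aux_int hΩopen hc hs (hS k) (hS0 k) (μs k))
      (aux_int hΩopen hc hs hg hg0 (μs k))
    have h3 : ∫ x in Ω, adjFP (A k) V f x ∂μs k
      = ∫ x in Ω, (S k x + fderiv ℝ f x (V x)) ∂μs k := rfl
    linarith
  set M : ℝ := ∑ i, ∑ j, B i j with hM
  have hM0 : 0 ≤ M := Finset.sum_nonneg fun i _ => Finset.sum_nonneg fun j _ => hB0 i j
  rw [Metric.tendsto_atTop]
  intro ε hε
  obtain ⟨N, hN⟩ := hA.2.2 _ (hs.trans hΩ𝒰) hc (ε / (2 * (M + 1))) (by positivity)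
  refine ⟨N, fun k hk => ?_⟩
  have := (hμs k).1.1
  rw [hkey k, dist_zero_right, norm_neg]
  have hb : ∀ x, ‖S k x‖ ≤ ε / (2 * (M + 1)) * M := by
    intro x
    by_cases hx : x ∈ tsupport f
    · rw [hM, Finset.mul_sum]
      refine (norm_sum_le _ _).trans (Finset.sum_le_sum fun i _ => ?_)
      rw [Finset.mul_sum]
      refine (norm_sum_le _ _).trans (Finset.sum_le_sum fun j _ => ?_)
      rw [norm_mul]
      exact mul_le_mul (hN k hk x hx i j) (hB i j x) (norm_nonneg _) (by positivity)
    · rw [hS0 k x hx, norm_zero]; positivity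
  have h4 := norm_setIntegral_le_of_norm_le_const (μ := μs k) (s := Ω)
    (measure_lt_top _ _) (fun x _ => hb x)
  have h5 : (μs k).real Ω ≤ 1 := measureReal_le_one
  have h6 : ε / (2 * (M + 1)) * M < ε := by
    rw [div_mul_eq_mul_div, div_lt_iff₀ (by positivity)]
    nlinarith
  have h7 : 0 ≤ ε / (2 * (M + 1)) * M := by positivity
  nlinarith

/-- Let `Ω ⊆ 𝒰` be a connected open set, `(A_k)` a null sequence of diffusion
matrices on `𝒰`, and for each `k` let `μ_k` be a stationary measure for `ℒ_{A_k}` on `Ω`.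
If `μ_k → μ` weak* on `Ω`, then `∫_Ω V(x)·∇h(x) dμ(x) = 0` for every `C¹` function
`h : ℝⁿ → ℝ` whose compact support is contained in `Ω`. -/
theorem stmt2 {n : ℕ} (hn : 1 ≤ n) (𝒰 Ω : Set (En n))
    (h𝒰open : IsOpen 𝒰) (h𝒰conn : IsConnected 𝒰)
    (V : En n → En n) (hV : ContinuousOn V 𝒰)
    (hΩopen : IsOpen Ω) (hΩconn : IsConnected Ω) (hΩ𝒰 : Ω ⊆ 𝒰)
    (A : ℕ → En n → Matrix (Fin n) (Fin n) ℝ) (hA : IsNullSeq 𝒰 A)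
    (μs : ℕ → Measure (En n)) (hμs : ∀ k, IsStationaryMeasure (A k) V Ω (μs k))
    (μ : Measure (En n)) (hμ : IsProbOn Ω μ) (hlim : WeakStarLimOn Ω μs μ) :
    ∀ h : En n → ℝ, ContDiff ℝ 1 h → HasCompactSupport h → tsupport h ⊆ Ω →
      ∫ x in Ω, fderiv ℝ h x (V x) ∂μ = 0 := by
  intro h hh hc hs
  have := hμ.1
  obtain ⟨δ, hδ, hδΩ⟩ := hc.isCompact.exists_cthickening_subset_open hΩopen hs
  have hK : IsCompact (Metric.cthickening δ (tsupport h)) := hc.isCompact.cthickening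
  have hVΩ := hV.mono hΩ𝒰
  obtain ⟨C, hC⟩ := hK.exists_bound_of_continuousOn (hVΩ.mono hδΩ)
  have key : ∀ ε > 0, |∫ x in Ω, fderiv ℝ h x (V x) ∂μ| ≤ ε * |C| := by
    intro ε hε
    obtain ⟨f, hf, hfs, hfh⟩ := aux_approx hh hc hδ hε
    have hfc : HasCompactSupport f := hK.of_isClosed_subset (isClosed_tsupport f) hfs
    have h0 := aux_smooth 𝒰 Ω V hV hΩopen hΩ𝒰 A hA μs hμs μ hlim f hf hfc (hfs.trans hδΩ)
    have z : ∀ (u : En n → ℝ), tsupport u ⊆ Metric.cthickening δ (tsupport h) →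
        ∀ x, x ∉ Metric.cthickening δ (tsupport h) → fderiv ℝ u x (V x) = 0 := by
      intro u hu x hx
      have : fderiv ℝ u x = 0 := by
        by_contra h'
        exact hx (hu (support_fderiv_subset ℝ h'))
      simp [this]
    have zf := z f hfs
    have zh := z h (Metric.self_subset_cthickening _)
    have cf : ContinuousOn (fun x => fderiv ℝ f x (V x)) Ω :=
      (hf.continuous_fderiv (by simp)).continuousOn.clm_apply hVΩ
    have ch : ContinuousOn (fun x => fderiv ℝ h x (V x)) Ω :=
      (hh.continuous_fderiv one_ne_zero).continuousOn.clm_apply hVΩ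
    have h1 := integral_sub (aux_int hΩopen hK hδΩ cf zf μ) (aux_int hΩopen hK hδΩ ch zh μ)
    have hb : ∀ x, ‖fderiv ℝ f x (V x) - fderiv ℝ h x (V x)‖ ≤ ε * |C| := by
      intro x
      by_cases hx : x ∈ Metric.cthickening δ (tsupport h)
      · have := (fderiv ℝ f x - fderiv ℝ h x).le_opNorm (V x)
        refine this.trans ?_
        exact mul_le_mul (hfh x) ((hC x hx).trans (le_abs_self _)) (norm_nonneg _) hε.le
      · rw [zf x hx, zh x hx, sub_zero, norm_zero]; positivity
    have h4 := norm_setIntegral_le_of_norm_le_const (μ := μ) (s := Ω)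
      (measure_lt_top _ _) (fun x _ => hb x)
    have h5 : μ.real Ω ≤ 1 := measureReal_le_one
    have h6 : 0 ≤ ε * |C| := by positivity
    rw [h1, h0, zero_sub, norm_neg, Real.norm_eq_abs] at h4
    nlinarith
  by_contra hne
  have hpos := abs_pos.2 hne
  have h1 := key (|∫ x in Ω, fderiv ℝ h x (V x) ∂μ| / (2 * (|C| + 1))) (by positivity)
  rw [div_mul_eq_mul_div, le_div_iff₀ (by positivity)] at h1
  nlinarith [abs_nonneg C]

end
end

section
/- Let V be a C¹ vector field on a connected open set 𝒰 ⊆ ℝⁿ, let Ω ⊆ 𝒰 be a connected open set which is invariant under the flow φ generated by V, let (A_k) be a null sequence of diffusion matrices on 𝒰, and for each k let μ_k be a Borel probability measure on Ω that is a stationary measure for ℒ_{A_k} on Ω. If μ_k converges weak* to a Borel probability measure μ on Ω, then μ is an invariant measure of the flow φ on Ω. -/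
open MeasureTheory Set Filter Topology

noncomputable section

/-- The flow generated by `V` on an invariant set `Ω`. -/
def IsFlowOn {n : ℕ} (V : En n → En n) (Ω : Set (En n)) (φ : ℝ → En n → En n) : Prop :=
  ContinuousOn (fun p : ℝ × En n => φ p.1 p.2) (univ ×ˢ Ω) ∧
  (∀ t : ℝ, ∀ x ∈ Ω, φ t x ∈ Ω) ∧
  (∀ x ∈ Ω, φ 0 x = x) ∧
  (∀ t s : ℝ, ∀ x ∈ Ω, φ (t + s) x = φ t (φ s x)) ∧
  (∀ x ∈ Ω, ∀ t : ℝ, HasDerivAt (fun τ => φ τ x) (V (φ t x)) t)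
/-- `μ` is an invariant measure of the flow `φ` on `Ω`:
`μ(φ(t,·)⁻¹(B)) = μ(B)` for every Borel `B ⊆ Ω` and every `t ∈ ℝ`. -/
def IsInvariantUnder {n : ℕ} (Ω : Set (En n)) (φ : ℝ → En n → En n)
    (μ : Measure (En n)) : Prop :=
  ∀ t : ℝ, ∀ B : Set (En n), B ⊆ Ω → MeasurableSet B → μ (Ω ∩ φ t ⁻¹' B) = μ B


lemma aux_cont_bdd {n : ℕ} {Ω K : Set (En n)} (hK : IsCompact K) (hKΩ : K ⊆ Ω)
    {F : En n → ℝ} (hF : ContinuousOn F Ω) (h0 : ∀ x ∉ K, F x = 0) : ∃ C, ∀ x, |F x| ≤ C := by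
  obtain ⟨C, hC⟩ := hK.exists_bound_of_continuousOn (hF.mono hKΩ)
  refine ⟨max C 0, fun x => ?_⟩
  by_cases hx : x ∈ K
  · exact (hC x hx).trans (le_max_left _ _)
  · simp [h0 x hx]

lemma aux_integrable {n : ℕ} {Ω : Set (En n)} (hΩ : IsOpen Ω) {F : En n → ℝ}
    (hF : ContinuousOn F Ω) {C : ℝ} (hC : ∀ x ∈ Ω, |F x| ≤ C) (μ : Measure (En n))
    [IsFiniteMeasure μ] : IntegrableOn F Ω μ := by
  refine Integrable.of_bound (hF.aestronglyMeasurable hΩ.measurableSet) C ?_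
  exact (ae_restrict_iff' hΩ.measurableSet).2 (ae_of_all _ hC)

lemma aux_fderiv_zero {n : ℕ} {f : En n → ℝ} {x : En n} (hx : x ∉ tsupport f) :
    fderiv ℝ f x = 0 := by
  by_contra h
  exact hx (support_fderiv_subset ℝ h)

lemma aux_cont_D {n : ℕ} {Ω : Set (En n)} {V : En n → En n} (hV : ContinuousOn V Ω)
    {f : En n → ℝ} (hf : ContDiff ℝ (⊤ : ℕ∞) f) : ContinuousOn (fun x => fderiv ℝ f x (V x)) Ω :=
  (hf.continuous_fderiv (by simp)).continuousOn.clm_apply hV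

lemma aux_limit {n : ℕ} {𝒰 Ω : Set (En n)} {V : En n → En n} (hV : ContinuousOn V Ω)
    (hΩopen : IsOpen Ω) (hΩ𝒰 : Ω ⊆ 𝒰)
    {A : ℕ → En n → Matrix (Fin n) (Fin n) ℝ} (hA : IsNullSeq 𝒰 A)
    {μs : ℕ → Measure (En n)} (hμs : ∀ k, IsStationaryMeasure (A k) V Ω (μs k))
    {μ : Measure (En n)} (hlim : WeakStarLimOn Ω μs μ)
    {f : En n → ℝ} (hf : ContDiff ℝ (⊤ : ℕ∞) f) (hfc : HasCompactSupport f)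
    (hfs : tsupport f ⊆ Ω) : ∫ x in Ω, fderiv ℝ f x (V x) ∂μ = 0 := by
  have hDc := aux_cont_D hV hf
  obtain ⟨C, hC⟩ := aux_cont_bdd hfc hfs hDc (fun x hx => by simp [aux_fderiv_zero hx])
  have h1 := hlim _ hDc ⟨C, fun x _ => hC x⟩
  refine tendsto_nhds_unique h1 ?_
  -- second-order term
  set H : Fin n → Fin n → En n → ℝ := fun i j x =>
    iteratedFDeriv ℝ 2 f x ![EuclideanSpace.single i (1 : ℝ), EuclideanSpace.single j (1 : ℝ)]
    with hH
  have hHc : ∀ i j, Continuous (H i j) := by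
    intro i j
    have := hf.continuous_iteratedFDeriv (m := 2) (by
      have h2 : ((2 : ℕ∞) : WithTop ℕ∞) ≤ ((⊤ : ℕ∞) : WithTop ℕ∞) := by
        exact WithTop.coe_le_coe.2 le_top
      exact h2)
    exact (ContinuousMultilinearMap.apply ℝ (fun _ : Fin 2 => En n) ℝ _).continuous.comp this
  have hH0 : ∀ i j, ∀ x ∉ tsupport f, H i j x = 0 := by
    intro i j x hx
    have : iteratedFDeriv ℝ 2 f x = 0 := by
      by_contra h
      exact hx (support_iteratedFDeriv_subset 2 h)
    simp [hH, this]
  have hHb : ∃ M, 0 ≤ M ∧ ∀ i j x, |H i j x| ≤ M := by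
    have : ∀ p : Fin n × Fin n, ∃ M, ∀ x, |H p.1 p.2 x| ≤ M := fun p =>
      aux_cont_bdd hfc hfs (hHc p.1 p.2).continuousOn (hH0 p.1 p.2)
    choose M hM using this
    refine ⟨∑ p, |M p|, by positivity, fun i j x => (hM (i, j) x).trans ((le_abs_self _).trans ?_)⟩
    exact Finset.single_le_sum (f := fun p => |M p|) (fun _ _ => abs_nonneg _) (Finset.mem_univ _)
  obtain ⟨M, hM0, hM⟩ := hHb
  rw [Metric.tendsto_atTop]
  intro ε hε
  set c : ℝ := n * n * M + 1 with hc
  have hcpos : 0 < c := by positivity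
  obtain ⟨N, hN⟩ := hA.2.2 (tsupport f) (hfs.trans hΩ𝒰) hfc (ε / (2 * c)) (by positivity)
  refine ⟨N, fun k hk => ?_⟩
  obtain ⟨⟨hp, hpΩ⟩, hst⟩ := hμs k
  have h0 := hst f hf hfc hfs
  have hAc : ∀ i j, ContinuousOn (fun x => A k x i j) Ω := fun i j =>
    ((continuous_id.matrix_elem i j).comp_continuousOn ((hA.1 k).mono hΩ𝒰))
  have hSc : ContinuousOn (fun x => ∑ i, ∑ j, A k x i j * H i j x) Ω :=
    continuousOn_finsetSum _ fun i _ => continuousOn_finsetSum _ fun j _ =>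
      (hAc i j).mul (hHc i j).continuousOn
  have hSb : ∀ x ∈ Ω, |∑ i, ∑ j, A k x i j * H i j x| ≤ ε / 2 := by
    intro x hx
    have : ∀ i j, |A k x i j * H i j x| ≤ ε / (2 * c) * M := by
      intro i j
      by_cases hxs : x ∈ tsupport f
      · rw [abs_mul]
        exact mul_le_mul (hN k hk x hxs i j) (hM i j x) (abs_nonneg _) (by positivity)
      · rw [hH0 i j x hxs]; simp; positivity
    calc |∑ i, ∑ j, A k x i j * H i j x| ≤ ∑ i : Fin n, ∑ j : Fin n, ε / (2 * c) * M :=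
          (Finset.abs_sum_le_sum_abs _ _).trans (Finset.sum_le_sum fun i _ =>
            (Finset.abs_sum_le_sum_abs _ _).trans (Finset.sum_le_sum fun j _ => this i j))
      _ = ε / (2 * c) * (n * n * M) := by simp; ring
      _ ≤ ε / (2 * c) * c := by gcongr; simp [hc]
      _ = ε / 2 := by field_simp
  have hS := aux_integrable hΩopen hSc hSb (μs k)
  have hD := aux_integrable hΩopen hDc (fun x _ => hC x) (μs k)
  have hadd : (∫ x in Ω, ∑ i, ∑ j, A k x i j * H i j x ∂μs k)
      + ∫ x in Ω, fderiv ℝ f x (V x) ∂μs k = 0 := by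
    rw [← integral_add hS hD]; exact h0
  have hle : ‖∫ x in Ω, ∑ i, ∑ j, A k x i j * H i j x ∂μs k‖ ≤ ε / 2 * (μs k).real Ω :=
    norm_setIntegral_le_of_norm_le_const (measure_lt_top _ _) hSb
  have hm : (μs k).real Ω ≤ 1 := measureReal_le_one
  rw [Real.norm_eq_abs] at hle
  rw [dist_zero_right, Real.norm_eq_abs]
  have : |∫ x in Ω, fderiv ℝ f x (V x) ∂μs k|
      = |∫ x in Ω, ∑ i, ∑ j, A k x i j * H i j x ∂μs k| := by
    rw [← abs_neg]; congr 1; linarith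
  rw [this]
  nlinarith

open Manifold in
lemma aux_meas {n : ℕ} {Ω : Set (En n)} (hΩ : IsOpen Ω) (ν μ : Measure (En n))
    [IsFiniteMeasure ν] [IsFiniteMeasure μ]
    (h : ∀ f : En n → ℝ, ContDiff ℝ (⊤ : ℕ∞) f → HasCompactSupport f → tsupport f ⊆ Ω →
      ∫ x, f x ∂ν = ∫ x, f x ∂μ) {B : Set (En n)} (hB : MeasurableSet B) (hBΩ : B ⊆ Ω) :
    ν B ≤ μ B := by
  have key : ∀ K, IsCompact K → K ⊆ Ω → ν K ≤ μ K := by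
    intro K hK hKΩ
    refine le_of_forall_gt fun r hr => ?_
    obtain ⟨U, hKU, hU, hUr⟩ := K.exists_isOpen_lt_of_lt r hr
    obtain ⟨L, hL, hKL, hLU⟩ := exists_compact_between hK (hU.inter hΩ) (subset_inter hKU hKΩ)
    obtain ⟨f, hf, hfr, hfs, hf1⟩ := exists_contMDiff_support_eq_eq_one_iff (n := (⊤ : ℕ∞)) 𝓘(ℝ, En n)
      isOpen_interior hK.isClosed hKL
    have hft : tsupport f ⊆ L := by
      rw [tsupport, hfs]; exact closure_minimal interior_subset hL.isClosed
    have hfc : HasCompactSupport f := HasCompactSupport.of_support_subset_isCompact hL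
      ((subset_tsupport f).trans hft)
    have hint : ∀ m : Measure (En n), IsFiniteMeasure m → Integrable f m := fun m _ =>
      hf.continuous.integrable_of_hasCompactSupport hfc
    have e := h f hf.contDiff hfc (hft.trans (hLU.trans inter_subset_right))
    have hf01 : ∀ x, f x ∈ Icc (0 : ℝ) 1 := fun x => hfr (mem_range_self x)
    have h1 : ν.real K ≤ ∫ x, f x ∂ν := by
      rw [← integral_indicator_one hK.measurableSet]
      refine integral_mono ((integrable_const (1:ℝ)).indicator hK.measurableSet) (hint ν inferInstance) fun x => ?_
      by_cases hx : x ∈ K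
      · simp [hx, (hf1 x).1 hx]
      · simp [hx, (hf01 x).1]
    have h2 : ∫ x, f x ∂μ ≤ μ.real U := by
      rw [← integral_indicator_one hU.measurableSet]
      refine integral_mono (hint μ inferInstance) ((integrable_const (1:ℝ)).indicator hU.measurableSet) fun x => ?_
      by_cases hx : x ∈ U
      · simp [hx, (hf01 x).2]
      · have : f x = 0 := by
          by_contra h0
          exact hx (hLU (hft (subset_tsupport f h0))).1
        simp [hx, this]
    have h3 : ν.real K ≤ μ.real U := by linarith
    have : ν K ≤ μ U := (ENNReal.toReal_le_toReal (measure_ne_top _ _) (measure_ne_top _ _)).1 h3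
    exact this.trans_lt hUr
  refine le_of_forall_lt fun r hr => ?_
  obtain ⟨K, hKB, hK, hrK⟩ := hB.exists_lt_isCompact_of_ne_top (measure_ne_top ν B) hr
  exact hrK.trans_le ((key K hK (hKB.trans hBΩ)).trans (measure_mono hKB))

lemma aux_flow_lip {n : ℕ} {Ω : Set (En n)} {V : En n → En n} (hV : ContDiffOn ℝ 1 V Ω)
    (hΩ : IsOpen Ω) {φ : ℝ → En n → En n} (hφ : IsFlowOn V Ω φ) {K : Set (En n)}
    (hK : IsCompact K) (hKΩ : K ⊆ Ω) {t : ℝ} (ht : 0 ≤ t) :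
    ∃ L : ℝ, 0 ≤ L ∧ ∀ x ∈ K, ∀ y ∈ K, dist (φ t x) (φ t y) ≤ L * dist x y := by
  obtain ⟨hc, hinv, h0, hadd, hd⟩ := hφ
  set C := (fun p : ℝ × En n => φ p.1 p.2) '' (Icc 0 t ×ˢ K) with hC
  have hCc : IsCompact C := (isCompact_Icc.prod hK).image_of_continuousOn
    (hc.mono (prod_mono (subset_univ _) hKΩ))
  have hCΩ : C ⊆ Ω := by
    rintro _ ⟨⟨s, x⟩, ⟨_, hx⟩, rfl⟩
    exact hinv s x (hKΩ hx)
  have hloc : LocallyLipschitzOn C V := by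
    intro x hx
    obtain ⟨L, T, hT, hL⟩ := (hV.contDiffAt (hΩ.mem_nhds (hCΩ hx))).exists_lipschitzOnWith
    exact ⟨L, T, mem_nhdsWithin_of_mem_nhds hT, hL⟩
  obtain ⟨L, hL⟩ := hloc.exists_lipschitzOnWith_of_compact hCc
  refine ⟨Real.exp (L * (t - 0)), by positivity, fun x hx y hy => ?_⟩
  have := dist_le_of_trajectories_ODE_of_mem (v := fun _ => V) (s := fun _ => C) (K := L)
    (f := fun s => φ s x) (g := fun s => φ s y) (a := 0) (b := t) (δ := dist x y)
    (fun _ _ => hL)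
    (fun s _ => (hd x (hKΩ hx) s).continuousAt.continuousWithinAt)
    (fun s _ => (hd x (hKΩ hx) s).hasDerivWithinAt)
    (fun s hs => ⟨(s, x), ⟨Ico_subset_Icc_self hs, hx⟩, rfl⟩)
    (fun s _ => (hd y (hKΩ hy) s).continuousAt.continuousWithinAt)
    (fun s _ => (hd y (hKΩ hy) s).hasDerivWithinAt)
    (fun s hs => ⟨(s, y), ⟨Ico_subset_Icc_self hs, hy⟩, rfl⟩)
    (by simp [h0 x (hKΩ hx), h0 y (hKΩ hy)]) t ⟨ht, le_rfl⟩
  rw [mul_comm]; exact this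

/-- functions Lipschitz on a neighbourhood of a compact support are Lipschitz -/
lemma aux_glob_lip {n : ℕ} {S : Set (En n)} {δ : ℝ} (hδ : 0 < δ) {g : En n → ℝ}
    (h0 : ∀ x ∉ S, g x = 0) {M L : ℝ} (hM : ∀ x, |g x| ≤ M) (hL0 : 0 ≤ L)
    (hL : ∀ x ∈ Metric.cthickening δ S, ∀ y ∈ Metric.cthickening δ S, |g x - g y| ≤ L * dist x y) :
    ∃ L', 0 ≤ L' ∧ ∀ x y, |g x - g y| ≤ L' * dist x y := by
  have hM0 : 0 ≤ M := (abs_nonneg _).trans (hM 0)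
  have key : ∀ x ∈ S, ∀ y, |g x - g y| ≤ (L + M / δ) * dist x y := by
    intro x hx y
    have hxt := Metric.self_subset_cthickening (δ := δ) S hx
    have : 0 ≤ M / δ := by positivity
    by_cases hy : y ∈ Metric.cthickening δ S
    · have := hL x hxt y hy
      have : 0 ≤ M / δ * dist x y := by positivity
      linarith
    · have hyS : y ∉ S := fun h => hy (Metric.self_subset_cthickening S h)
      have hd : δ ≤ dist x y := by
        by_contra hlt
        exact hy (Metric.mem_cthickening_of_dist_le y x δ S hx (by rw [dist_comm]; linarith))
      rw [h0 y hyS, sub_zero]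
      have h1 : M = M / δ * δ := by field_simp
      have h2 : M / δ * δ ≤ M / δ * dist x y := by gcongr
      have h3 : 0 ≤ L * dist x y := by positivity
      have := hM x
      linarith
  refine ⟨L + M / δ, by positivity, fun x y => ?_⟩
  by_cases hx : x ∈ S
  · exact key x hx y
  by_cases hy : y ∈ S
  · rw [abs_sub_comm, dist_comm]; exact key y hy x
  · rw [h0 x hx, h0 y hy]; simp; positivity

lemma aux_step {n : ℕ} {Ω : Set (En n)} {V : En n → En n}
    {φ : ℝ → En n → En n} (hφ : IsFlowOn V Ω φ) {g h : En n → ℝ} {L : ℝ} (hL0 : 0 ≤ L)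
    (hL : ∀ x y, |g x - g y| ≤ L * dist x y)
    (hgd : ∀ z ∈ Ω, ∀ s, HasDerivAt (fun s => g (φ s z)) (h (φ s z)) s)
    {η δ : ℝ} {x z : En n} (hz : z ∈ Ω)
    (hVb : ∀ r, |r| < δ → ‖V (φ r z) - V x‖ ≤ η) (hhb : ∀ r, |r| < δ → ‖h (φ r z) - h x‖ ≤ η)
    {s : ℝ} (hs : |s| < δ) :
    |g (z + s • V x) - g z - s * h x| ≤ (L + 1) * η * |s| := by
  obtain ⟨hc, hinv, h0, hadd, hd⟩ := hφ
  have hδ : 0 < δ := (abs_nonneg _).trans_lt hs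
  have hball : ∀ r ∈ Metric.ball (0:ℝ) δ, |r| < δ := fun r hr => by simpa using hr
  have hs' : s ∈ Metric.ball (0:ℝ) δ := by simpa using hs
  have e1 := Convex.norm_image_sub_le_of_norm_hasDerivWithin_le (s := Metric.ball (0:ℝ) δ)
    (f := fun r => g (φ r z) - r * h x) (f' := fun r => h (φ r z) - 1 * h x) (C := η)
    (fun r _ => ((hgd z hz r).sub ((hasDerivAt_id r).mul_const _)).hasDerivWithinAt)
    (fun r hr => by rw [one_mul]; exact hhb r (hball r hr)) (convex_ball _ _)
    (Metric.mem_ball_self hδ) hs'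
  have e2 := Convex.norm_image_sub_le_of_norm_hasDerivWithin_le (s := Metric.ball (0:ℝ) δ)
    (f := fun r => φ r z - r • V x) (f' := fun r => V (φ r z) - (1:ℝ) • V x) (C := η)
    (fun r _ => ((hd z hz r).sub ((hasDerivAt_id r).smul_const _)).hasDerivWithinAt)
    (fun r hr => by rw [one_smul]; exact hVb r (hball r hr)) (convex_ball _ _)
    (Metric.mem_ball_self hδ) hs'
  simp only [h0 z hz, zero_mul, zero_smul, sub_zero, Real.norm_eq_abs] at e1 e2
  have e3 := hL (z + s • V x) (φ s z)
  have e4 : dist (z + s • V x) (φ s z) = ‖φ s z - s • V x - z‖ := by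
    rw [dist_comm, dist_eq_norm]; congr 1; abel
  rw [e4] at e3
  have e5 : L * ‖φ s z - s • V x - z‖ ≤ L * (η * |s|) := by gcongr
  have e6 : g (z + s • V x) - g z - s * h x
    = (g (z + s • V x) - g (φ s z)) + (g (φ s z) - s * h x - g z) := by ring
  rw [e6]
  refine (abs_add_le _ _).trans ?_
  linarith

lemma aux_moll {n : ℕ} {Ω : Set (En n)} {V : En n → En n} (hV : ContinuousOn V Ω)
    (hΩ : IsOpen Ω) {φ : ℝ → En n → En n} (hφ : IsFlowOn V Ω φ) {g h : En n → ℝ}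
    {L : ℝ} (hL0 : 0 ≤ L)
    (hL : ∀ x y, |g x - g y| ≤ L * dist x y) {S : Set (En n)} (hS : IsCompact S) (hSΩ : S ⊆ Ω)
    (hg0 : ∀ x ∉ S, g x = 0) (hh0 : ∀ x ∉ S, h x = 0) (hh : ContinuousOn h Ω)
    (hgd : ∀ z ∈ Ω, ∀ s, HasDerivAt (fun s => g (φ s z)) (h (φ s z)) s) {η : ℝ} (hη : 0 < η) :
    ∃ G : En n → ℝ, ContDiff ℝ (⊤ : ℕ∞) G ∧ HasCompactSupport G ∧ tsupport G ⊆ Ω ∧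
      ∀ x, |fderiv ℝ G x (V x) - h x| ≤ η := by
  have hφ' := hφ
  obtain ⟨hc, hinv, h0, hadd, hd⟩ := hφ
  obtain ⟨δ₀, hδ₀, hK1Ω⟩ := hS.exists_cthickening_subset_open hΩ hSΩ
  set K1 := Metric.cthickening δ₀ S with hK1
  have hK1c : IsCompact K1 := hS.cthickening
  obtain ⟨δ₂, hδ₂, hK2Ω⟩ := hK1c.exists_cthickening_subset_open hΩ hK1Ω
  have hgc : Continuous g := by
    have : LipschitzWith ⟨L, hL0⟩ g := LipschitzWith.of_dist_le_mul hL
    exact this.continuous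
  -- uniform control
  set η' := η / (L + 1) with hη'
  have hη'0 : 0 < η' := by positivity
  set F : ℝ × En n → En n × ℝ := fun p => (V (φ p.1 p.2), h (φ p.1 p.2)) with hF
  have hFc : ∀ a ∈ ({0} : Set ℝ) ×ˢ K1, ContinuousAt F a := by
    rintro ⟨r, x⟩ ⟨_, hx⟩
    have hxΩ : x ∈ Ω := hK1Ω hx
    have hφc : ContinuousAt (fun p : ℝ × En n => φ p.1 p.2) (r, x) :=
      hc.continuousAt ((isOpen_univ.prod hΩ).mem_nhds ⟨mem_univ _, hxΩ⟩)
    have hm := hΩ.mem_nhds (hinv r x hxΩ)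
    have c1 : ContinuousAt (fun p : ℝ × En n => V (φ p.1 p.2)) (r, x) :=
      ContinuousAt.comp (g := V) (hV.continuousAt hm) hφc
    have c2 : ContinuousAt (fun p : ℝ × En n => h (φ p.1 p.2)) (r, x) :=
      ContinuousAt.comp (g := h) (hh.continuousAt hm) hφc
    exact c1.prodMk c2
  obtain ⟨δ₁, hδ₁, hU⟩ := Metric.mem_uniformity_dist.1
    ((isCompact_singleton.prod hK1c).uniformContinuousAt_of_continuousAt F hFc
      (Metric.dist_mem_uniformity hη'0))
  set δ := min δ₁ (min δ₂ δ₀) with hδ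
  have hδpos : 0 < δ := by positivity
  have hδ1 : δ ≤ δ₁ := min_le_left _ _
  have hδ2 : δ ≤ δ₂ := (min_le_right _ _).trans (min_le_left _ _)
  have hδ0 : δ ≤ δ₀ := (min_le_right _ _).trans (min_le_right _ _)
  have hctrl : ∀ x ∈ K1, ∀ z, dist x z < δ → z ∈ Ω ∧ ∀ r, |r| < δ →
      ‖V (φ r z) - V x‖ ≤ η' ∧ ‖h (φ r z) - h x‖ ≤ η' := by
    intro x hx z hxz
    refine ⟨hK2Ω (Metric.mem_cthickening_of_dist_le z x δ₂ K1 hx ?_), fun r hr => ?_⟩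
    · rw [dist_comm]; linarith
    · have hdist : dist ((0:ℝ), x) (r, z) < δ₁ := by
        rw [Prod.dist_eq]
        refine max_lt ?_ (by linarith)
        simp; linarith
      have := hU hdist ⟨rfl, hx⟩
      simp only [mem_ofPred_eq, hF, Prod.dist_eq, h0 x (hK1Ω hx), max_lt_iff] at this
      rw [dist_comm, dist_eq_norm, dist_comm, dist_eq_norm] at this
      exact ⟨this.1.le, this.2.le⟩
  -- mollification
  let ρ : ContDiffBump (0 : En n) := ⟨δ / 2, δ, by positivity, by linarith⟩
  set w : En n → ℝ := ρ.normed volume with hw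
  have hwc : Continuous w := ρ.continuous_normed
  have hwcs : HasCompactSupport w := ρ.hasCompactSupport_normed
  have hw0 : ∀ y, 0 ≤ w y := fun y => ρ.nonneg_normed y
  have hwint : ∫ y, w y = 1 := ρ.integral_normed
  have hwi : Integrable w := ρ.integrable_normed
  have hwsupp : ∀ y, δ ≤ ‖y‖ → w y = 0 := by
    intro y hy
    by_contra hne
    have : y ∈ Function.support w := hne
    rw [hw, ρ.support_normed_eq] at this
    have h2 : ‖y‖ < δ := by simpa using this
    linarith
  set G : En n → ℝ := fun x => ∫ y, w y * g (x - y) with hG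
  have hGconv : G = MeasureTheory.convolution w g (ContinuousLinearMap.lsmul ℝ ℝ) volume := by
    ext x; simp [hG, MeasureTheory.convolution]
  have hGs : ContDiff ℝ (⊤ : ℕ∞) G := by
    rw [hGconv]
    exact hwcs.contDiff_convolution_left _ ρ.contDiff_normed hgc.locallyIntegrable
  have hG0 : ∀ x ∉ K1, G x = 0 := by
    intro x hx
    have : ∀ y, w y * g (x - y) = 0 := by
      intro y
      by_cases hy : δ ≤ ‖y‖
      · simp [hwsupp y hy]
      · rw [hg0 (x - y), mul_zero]
        intro hxy
        refine hx (Metric.mem_cthickening_of_dist_le x (x - y) δ₀ S hxy ?_)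
        rw [dist_eq_norm, sub_sub_cancel]; linarith
    simp [hG, this]
  have hGsupp : tsupport G ⊆ K1 := closure_minimal
    (fun x hx => by by_contra hn; exact hx (hG0 x hn)) hK1c.isClosed
  refine ⟨G, hGs, hK1c.of_isClosed_subset (isClosed_tsupport G) hGsupp, hGsupp.trans hK1Ω, ?_⟩
  intro x
  by_cases hx : x ∈ K1
  swap
  · rw [aux_fderiv_zero (fun h => hx (hGsupp h)),
      hh0 x (fun h => hx (Metric.self_subset_cthickening S h))]
    simp [hη.le]
  have hint : ∀ x, Integrable (fun y => w y * g (x - y)) := fun x =>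
    Continuous.integrable_of_hasCompactSupport (by fun_prop) hwcs.mul_right
  have hdiff : ∀ s : ℝ, |s| < δ → |G (x + s • V x) - s * h x - G x| ≤ η * |s| := by
    intro s hs
    have e : G (x + s • V x) - s * h x - G x
        = ∫ y, w y * (g (x - y + s • V x) - g (x - y) - s * h x) := by
      have e1 : s * h x = ∫ y, w y * (s * h x) := by
        rw [integral_mul_const, hwint, one_mul]
      have e2 : ∫ y, (w y * g (x + s • V x - y) - w y * (s * h x) - w y * g (x - y))
          = G (x + s • V x) - (∫ y, w y * (s * h x)) - G x := by
        have i1 : Integrable (fun y => w y * g (x + s • V x - y) - w y * (s * h x)) :=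
          (hint _).sub (hwi.mul_const _)
        rw [integral_sub i1 (hint _), integral_sub (hint _) (hwi.mul_const _)]
      rw [← e1] at e2
      rw [← e2]
      congr 1; ext y
      rw [show x + s • V x - y = x - y + s • V x by abel]; ring
    rw [e]
    have hb : ∀ y, ‖w y * (g (x - y + s • V x) - g (x - y) - s * h x)‖ ≤ w y * (η * |s|) := by
      intro y
      by_cases hy : δ ≤ ‖y‖
      · simp [hwsupp y hy]
      · rw [norm_mul, Real.norm_of_nonneg (hw0 y)]
        refine mul_le_mul_of_nonneg_left ?_ (hw0 y)
        obtain ⟨hz, hr⟩ := hctrl x hx (x - y) (by rw [dist_eq_norm, sub_sub_cancel]; linarith)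
        have := aux_step hφ' hL0 hL hgd hz (fun r h => (hr r h).1) (fun r h => (hr r h).2) hs
        have e7 : (L + 1) * η' = η := by rw [hη']; field_simp
        rw [e7] at this
        exact this
    have := norm_integral_le_of_norm_le (hwi.mul_const (η * |s|)) (ae_of_all _ hb)
    rwa [integral_mul_const, hwint, one_mul] at this
  have hder : HasDerivAt (fun s : ℝ => G (x + s • V x) - s * h x)
      (fderiv ℝ G x (V x) - 1 * h x) 0 := by
    refine HasDerivAt.sub ?_ ((hasDerivAt_id _).mul_const _)
    have hGd : HasFDerivAt G (fderiv ℝ G x) (x + (0:ℝ) • V x) := by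
      rw [zero_smul, add_zero]
      exact (hGs.differentiable (by simp) x).hasFDerivAt
    have hl : HasDerivAt (fun s : ℝ => x + s • V x) (V x) 0 := by
      simpa using ((hasDerivAt_id (0:ℝ)).smul_const (V x)).const_add x
    exact hGd.comp_hasDerivAt 0 hl
  have := hder.hasFDerivAt.le_of_lip' hη.le (by
    filter_upwards [Metric.ball_mem_nhds (0:ℝ) hδpos] with s hs
    have hs' : |s| < δ := by simpa using hs
    simpa using hdiff s hs')
  simpa using this

/-- invariance of integrals of test functions for nonnegative times -/
lemma aux_inv {n : ℕ} {Ω : Set (En n)} {V : En n → En n} (hV : ContDiffOn ℝ 1 V Ω)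
    (hΩ : IsOpen Ω) {φ : ℝ → En n → En n} (hφ : IsFlowOn V Ω φ) {μ : Measure (En n)}
    [IsProbabilityMeasure μ]
    (hlim : ∀ f : En n → ℝ, ContDiff ℝ (⊤ : ℕ∞) f → HasCompactSupport f → tsupport f ⊆ Ω →
      ∫ x in Ω, fderiv ℝ f x (V x) ∂μ = 0)
    {f : En n → ℝ} (hf : ContDiff ℝ (⊤ : ℕ∞) f) (hfc : HasCompactSupport f)
    (hfs : tsupport f ⊆ Ω) {T : ℝ} (hT : 0 ≤ T) :
    ∫ x in Ω, f (φ T x) ∂μ = ∫ x in Ω, f x ∂μ := by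
  classical
  have hφ' := hφ
  obtain ⟨hc, hinv, h0, hadd, hd⟩ := hφ
  have hVc := hV.continuousOn
  set D : En n → ℝ := fun x => fderiv ℝ f x (V x) with hD
  have hDc : ContinuousOn D Ω := aux_cont_D hVc hf
  have hD0 : ∀ x ∉ tsupport f, D x = 0 := fun x hx => by simp [hD, aux_fderiv_zero hx]
  obtain ⟨C, hC⟩ := aux_cont_bdd hfc hfs hDc hD0
  obtain ⟨M, hM⟩ := aux_cont_bdd hfc hfs hf.continuous.continuousOn
    (fun x hx => image_eq_zero_of_notMem_tsupport hx)
  have hφc : ∀ t, ContinuousOn (φ t) Ω := fun t =>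
    hc.comp (f := fun x => (t, x)) (by fun_prop) (fun x hx => ⟨mem_univ _, hx⟩)
  have hderiv : ∀ z ∈ Ω, ∀ t, HasDerivAt (fun t => f (φ t z)) (D (φ t z)) t := fun z hz t =>
    (hf.differentiable (by simp) (φ t z)).hasFDerivAt.comp_hasDerivAt t (hd z hz t)
  have hfφ : ∀ t, ContinuousOn (fun x => f (φ t x)) Ω := fun t =>
    hf.continuous.comp_continuousOn (hφc t)
  have hDφ : ∀ t, ContinuousOn (fun x => D (φ t x)) Ω := fun t =>
    hDc.comp (hφc t) (fun x hx => hinv t x hx)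
  -- the derivative vanishes
  have hzero : ∀ t, 0 ≤ t → ∫ x in Ω, D (φ t x) ∂μ = 0 := by
    intro t ht
    set S := φ (-t) '' tsupport f with hS
    have hSc : IsCompact S := hfc.isCompact.image_of_continuousOn ((hφc (-t)).mono hfs)
    have hSΩ : S ⊆ Ω := by
      rintro _ ⟨x, hx, rfl⟩; exact hinv _ _ (hfs hx)
    have hback : ∀ s, ∀ x ∈ Ω, φ (-s) (φ s x) = x := fun s x hx => by
      rw [← hadd _ _ x hx, neg_add_cancel, h0 x hx]
    have hnot : ∀ x ∈ Ω, x ∉ S → φ t x ∉ tsupport f := fun x hx hxS h =>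
      hxS ⟨φ t x, h, hback t x hx⟩
    set g : En n → ℝ := Ω.indicator (fun x => f (φ t x)) with hg
    set h : En n → ℝ := Ω.indicator (fun x => D (φ t x)) with hh
    have hgΩ : ∀ x ∈ Ω, g x = f (φ t x) := fun x hx => indicator_of_mem hx _
    have hhΩ : ∀ x ∈ Ω, h x = D (φ t x) := fun x hx => indicator_of_mem hx _
    have hg0 : ∀ x ∉ S, g x = 0 := by
      intro x hx
      by_cases hxΩ : x ∈ Ω
      · rw [hgΩ x hxΩ]; exact image_eq_zero_of_notMem_tsupport (hnot x hxΩ hx)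
      · exact indicator_of_notMem hxΩ _
    have hh0 : ∀ x ∉ S, h x = 0 := by
      intro x hx
      by_cases hxΩ : x ∈ Ω
      · rw [hhΩ x hxΩ]; exact hD0 _ (hnot x hxΩ hx)
      · exact indicator_of_notMem hxΩ _
    have hgM : ∀ x, |g x| ≤ M := by
      intro x
      by_cases hxΩ : x ∈ Ω
      · rw [hgΩ x hxΩ]; exact hM _
      · rw [hg, indicator_of_notMem hxΩ]; simpa using (abs_nonneg _).trans (hM 0)
    obtain ⟨δ, hδ, hKΩ⟩ := hSc.exists_cthickening_subset_open hΩ hSΩ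
    obtain ⟨L₁, hL₁, hlip⟩ := aux_flow_lip hV hΩ hφ' hSc.cthickening hKΩ ht
    obtain ⟨L₂, hflip⟩ := (hf.of_le (m := 1) (by
      have h2 : ((1 : ℕ∞) : WithTop ℕ∞) ≤ ((⊤ : ℕ∞) : WithTop ℕ∞) := WithTop.coe_le_coe.2 le_top
      exact h2)).lipschitzWith_of_hasCompactSupport hfc (by simp)
    obtain ⟨L, hL0, hL⟩ := aux_glob_lip hδ hg0 hgM (L := L₂ * L₁) (by positivity) (by
      intro x hx y hy
      rw [hgΩ x (hKΩ hx), hgΩ y (hKΩ hy)]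
      refine (hflip.dist_le_mul _ _).trans ?_
      rw [mul_assoc]
      exact mul_le_mul_of_nonneg_left (hlip x hx y hy) L₂.2)
    have hhc : ContinuousOn h Ω := (hDφ t).congr hhΩ
    have hgd : ∀ z ∈ Ω, ∀ s, HasDerivAt (fun s => g (φ s z)) (h (φ s z)) s := by
      intro z hz s
      have e1 : (fun s => g (φ s z)) = fun s => f (φ (t + s) z) := by
        ext s; rw [hgΩ _ (hinv s z hz), hadd t s z hz]
      rw [e1, hhΩ _ (hinv s z hz), ← hadd t s z hz]
      exact (hderiv z hz (t + s)).comp_const_add t s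
    have hhb : ∀ x ∈ Ω, |h x| ≤ C := fun x hx => by rw [hhΩ x hx]; exact hC _
    have hhi := aux_integrable hΩ hhc hhb μ
    have e : ∫ x in Ω, D (φ t x) ∂μ = ∫ x in Ω, h x ∂μ :=
      setIntegral_congr_fun hΩ.measurableSet fun x hx => (hhΩ x hx).symm
    rw [e]
    refine abs_eq_zero.1 (le_antisymm (le_of_forall_pos_le_add fun η hη => ?_) (abs_nonneg _))
    obtain ⟨G, hGs, hGc, hGΩ, hGh⟩ :=
      aux_moll hVc hΩ hφ' hL0 hL hSc hSΩ hg0 hh0 hhc hgd hη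
    have hGz := hlim G hGs hGc hGΩ
    obtain ⟨C', hC'⟩ := aux_cont_bdd hGc hGΩ (aux_cont_D hVc hGs)
      (fun x hx => by simp [aux_fderiv_zero hx])
    have hGi := aux_integrable hΩ (aux_cont_D hVc hGs) (fun x _ => hC' x) μ
    have hle : ‖∫ x in Ω, (fderiv ℝ G x (V x) - h x) ∂μ‖ ≤ η * μ.real Ω :=
      norm_setIntegral_le_of_norm_le_const (measure_lt_top _ _) (fun x _ => hGh x)
    rw [integral_sub hGi hhi, hGz, zero_sub, norm_neg, Real.norm_eq_abs] at hle
    have hm : μ.real Ω ≤ 1 := measureReal_le_one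
    nlinarith
  have hG' : ∀ t, HasDerivAt (fun t => ∫ x in Ω, f (φ t x) ∂μ) (∫ x in Ω, D (φ t x) ∂μ) t := by
    intro t
    refine (hasDerivAt_integral_of_dominated_loc_of_deriv_le (μ := μ.restrict Ω)
      (F := fun t x => f (φ t x)) (F' := fun t x => D (φ t x)) (bound := fun _ => C)
      (s := univ) univ_mem ?_ ?_ ?_ ?_ ?_ ?_).2
    · exact Eventually.of_forall fun s => (hfφ s).aestronglyMeasurable hΩ.measurableSet
    · exact aux_integrable hΩ (hfφ t) (fun x _ => hM _) μ
    · exact (hDφ t).aestronglyMeasurable hΩ.measurableSet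
    · exact ae_of_all _ fun x s _ => hC _
    · exact integrable_const _
    · exact (ae_restrict_iff' hΩ.measurableSet).2 (ae_of_all _ fun x hx s _ => hderiv x hx s)
  have := Convex.norm_image_sub_le_of_norm_hasDerivWithin_le (s := Ici (0:ℝ)) (C := 0)
    (fun r _ => (hG' r).hasDerivWithinAt) (fun r hr => by rw [hzero r hr, norm_zero])
    (convex_Ici _) (x := 0) (y := T) (by simp) hT
  rw [zero_mul] at this
  have := sub_eq_zero.1 (norm_le_zero_iff.1 this)
  rw [this]
  exact setIntegral_congr_fun hΩ.measurableSet fun x hx => by simp only [h0 x hx]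

/-- Let `V` be a `C¹` vector field on a connected open set `𝒰 ⊆ ℝⁿ`, let
`Ω ⊆ 𝒰` be a connected open set invariant under the flow `φ` generated by `V`, let `(A_k)` be a
null sequence of diffusion matrices on `𝒰`, and for each `k` let `μ_k` be a stationary measure
for `ℒ_{A_k}` on `Ω`. If `μ_k → μ` weak* on `Ω`, then `μ` is an invariant measure of the flow
`φ` on `Ω`. -/
theorem stmt3 {n : ℕ} (hn : 1 ≤ n) (𝒰 Ω : Set (En n))
    (h𝒰open : IsOpen 𝒰) (h𝒰conn : IsConnected 𝒰)
    (V : En n → En n) (hV : ContDiffOn ℝ 1 V 𝒰)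
    (hΩopen : IsOpen Ω) (hΩconn : IsConnected Ω) (hΩ𝒰 : Ω ⊆ 𝒰)
    (φ : ℝ → En n → En n) (hφ : IsFlowOn V Ω φ)
    (A : ℕ → En n → Matrix (Fin n) (Fin n) ℝ) (hA : IsNullSeq 𝒰 A)
    (μs : ℕ → Measure (En n)) (hμs : ∀ k, IsStationaryMeasure (A k) V Ω (μs k))
    (μ : Measure (En n)) (hμ : IsProbOn Ω μ) (hlim : WeakStarLimOn Ω μs μ) :
    IsInvariantUnder Ω φ μ := by
  obtain ⟨hp, hμΩ⟩ := hμ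
  have hV' : ContDiffOn ℝ 1 V Ω := hV.mono hΩ𝒰
  have hlim' : ∀ f : En n → ℝ, ContDiff ℝ (⊤ : ℕ∞) f → HasCompactSupport f → tsupport f ⊆ Ω →
      ∫ x in Ω, fderiv ℝ f x (V x) ∂μ = 0 := fun f hf hfc hfs =>
    aux_limit hV'.continuousOn hΩopen hΩ𝒰 hA hμs hlim hf hfc hfs
  have hφc : ∀ t, ContinuousOn (φ t) Ω := fun t =>
    hφ.1.comp (f := fun x => (t, x)) (by fun_prop) (fun x hx => ⟨mem_univ _, hx⟩)
  have hmeas : ∀ t, ∀ B : Set (En n), MeasurableSet B → MeasurableSet (Ω ∩ φ t ⁻¹' B) := by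
    intro t B hB
    have h1 : Measurable (Ω.domRestrict (φ t)) := (hφc t).domRestrict.measurable
    have h2 := (MeasurableEmbedding.subtype_coe hΩopen.measurableSet).measurableSet_image.2 (h1 hB)
    convert h2 using 1
    ext x; simp [Set.domRestrict, and_comm]
  have hpos : ∀ t : ℝ, 0 ≤ t → ∀ B : Set (En n), B ⊆ Ω → MeasurableSet B →
      μ (Ω ∩ φ t ⁻¹' B) = μ B := by
    intro t ht B hBΩ hB
    have hae : AEMeasurable (φ t) (μ.restrict Ω) := (hφc t).aemeasurable hΩopen.measurableSet
    have hf : ∀ f : En n → ℝ, ContDiff ℝ (⊤ : ℕ∞) f → HasCompactSupport f → tsupport f ⊆ Ω →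
        ∫ x, f x ∂((μ.restrict Ω).map (φ t)) = ∫ x, f x ∂(μ.restrict Ω) := by
      intro f hf hfc hfs
      rw [integral_map hae hf.continuous.aestronglyMeasurable]
      exact aux_inv hV' hΩopen hφ hlim' hf hfc hfs ht
    have e := le_antisymm (aux_meas hΩopen _ _ hf hB hBΩ)
      (aux_meas hΩopen _ _ (fun f h1 h2 h3 => (hf f h1 h2 h3).symm) hB hBΩ)
    rw [Measure.map_apply_of_aemeasurable hae hB, Measure.restrict_apply' hΩopen.measurableSet,
      Measure.restrict_apply' hΩopen.measurableSet, inter_eq_left.2 hBΩ, inter_comm] at e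
    exact e
  intro t B hBΩ hB
  rcases le_total 0 t with ht | ht
  · exact hpos t ht B hBΩ hB
  · have e := hpos (-t) (by linarith) (Ω ∩ φ t ⁻¹' B) inter_subset_left (hmeas t B hB)
    rw [← e]
    congr 1
    obtain ⟨_, hinv, h0, hadd, _⟩ := hφ
    ext x
    constructor
    · rintro ⟨hx, _, hx2⟩
      have : φ t (φ (-t) x) = x := by rw [← hadd _ _ x hx, add_neg_cancel, h0 x hx]
      rw [mem_preimage, this] at hx2
      exact hx2
    · intro hx
      refine ⟨hBΩ hx, hinv _ _ (hBΩ hx), ?_⟩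
      rw [mem_preimage, ← hadd _ _ x (hBΩ hx), add_neg_cancel, h0 x (hBΩ hx)]
      exact hx

end
end

section
/- Let Ω ⊆ 𝒰 be a connected open set, let (A_k) be a null sequence of diffusion matrices on 𝒰, and suppose there is a uniform Lyapunov function U on Ω with respect to (ℒ_{A_k}), with essential lower bound ρ_m and constant γ > 0. For each k let μ_k be a Borel probability measure on Ω that is a stationary measure for ℒ_{A_k} on Ω. Then the family {μ_k} is tight: for every ε > 0 there is a compact set K ⊆ Ω such that μ_k(Ω \ K) < ε for all k; consequently {μ_k} is relatively sequentially compact in the weak* topology on Borel probability measures on Ω. -/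
open MeasureTheory Set Filter Topology

noncomputable section

/-- A compact function on `Ω`: a continuous nonnegative function `U` with
`U x < ρ_M := sup_Ω U` everywhere and compact sublevel sets `{x ∈ Ω | U x ≤ ρ}`
for every `ρ < ρ_M` (the supremum is taken in `EReal`, allowing `ρ_M = ∞`). -/
def IsCompactFunctionOn {n : ℕ} (U : En n → ℝ) (Ω : Set (En n)) : Prop :=
  ContinuousOn U Ω ∧ (∀ x ∈ Ω, 0 ≤ U x) ∧
  (∀ x ∈ Ω, (U x : EReal) < ⨆ y ∈ Ω, (U y : EReal)) ∧
  (∀ ρ : ℝ, (ρ : EReal) < ⨆ y ∈ Ω, (U y : EReal) → IsCompact {x ∈ Ω | U x ≤ ρ})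
/-- `U` is a uniform Lyapunov function on `Ω` with respect to `(ℒ_{A_k})`, with essential lower
bound `ρ_m` and constant `γ`: `U` is a `C²` compact function on `Ω` with `ρ_m ∈ (0, ρ_M)`,
`γ > 0`, and `ℒ_{A_k}U(x) ≤ −γ` for every `k` and every `x ∈ Ω` with `U(x) > ρ_m`. -/
def IsUniformLyap {n : ℕ} (A : ℕ → En n → Matrix (Fin n) (Fin n) ℝ) (V : En n → En n)
    (Ω : Set (En n)) (U : En n → ℝ) (ρm γ : ℝ) : Prop :=
  ContDiffOn ℝ 2 U Ω ∧ IsCompactFunctionOn U Ω ∧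
  0 < ρm ∧ ((ρm : EReal) < ⨆ y ∈ Ω, (U y : EReal)) ∧ 0 < γ ∧
  ∀ k, ∀ x ∈ Ω, ρm < U x → adjFP (A k) V U x ≤ -γ

open scoped Convolution

theorem fderiv_moll {n : ℕ} {F : Type*} [NormedAddCommGroup F] [NormedSpace ℝ F] [CompleteSpace F]
    (φ : ContDiffBump (0 : En n)) (g : En n → F) (hg : ContDiff ℝ 1 g) (hc : HasCompactSupport g) :
    fderiv ℝ (φ.normed volume ⋆[ContinuousLinearMap.lsmul ℝ ℝ, volume] g) =
      (φ.normed volume ⋆[ContinuousLinearMap.lsmul ℝ ℝ, volume] (fderiv ℝ g)) := by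
  funext x
  have h := hc.hasFDerivAt_convolution_right (μ := (volume : Measure (En n)))
    (ContinuousLinearMap.lsmul ℝ ℝ)
    (φ.continuous_normed (μ := volume)).locallyIntegrable hg x
  rw [h.fderiv]
  congr 1

theorem moll_close {n : ℕ} {F : Type*} [NormedAddCommGroup F] [NormedSpace ℝ F] [CompleteSpace F]
    (g : En n → F) (hu : UniformContinuous g) (δ : ℝ) (hδ : 0 < δ) :
    ∃ r > 0, ∀ φ : ContDiffBump (0 : En n), φ.rOut ≤ r → ∀ x,
      ‖(φ.normed volume ⋆[ContinuousLinearMap.lsmul ℝ ℝ, volume] g) x - g x‖ ≤ δ := by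
  obtain ⟨r, hr, H⟩ := Metric.uniformContinuous_iff.1 hu δ hδ
  refine ⟨r, hr, fun φ hφ x => ?_⟩
  rw [← dist_eq_norm]
  apply φ.dist_normed_convolution_le hu.continuous.aestronglyMeasurable
  intro y hy
  exact (H (lt_of_lt_of_le (Metric.mem_ball.1 hy) hφ)).le

/-- smooth approximation of `C²` compactly supported functions -/
theorem smooth_approx {n : ℕ} (g : En n → ℝ) (hg : ContDiff ℝ 2 g) (hc : HasCompactSupport g)
    (Ω : Set (En n)) (hΩ : IsOpen Ω) (hs : tsupport g ⊆ Ω) :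
    ∃ K ⊆ Ω, IsCompact K ∧ tsupport g ⊆ K ∧ ∀ δ > 0, ∃ f : En n → ℝ, ContDiff ℝ (⊤ : ℕ∞) f ∧
      tsupport f ⊆ K ∧ (∀ x, ‖fderiv ℝ f x - fderiv ℝ g x‖ ≤ δ) ∧
      (∀ x, ‖fderiv ℝ (fderiv ℝ f) x - fderiv ℝ (fderiv ℝ g) x‖ ≤ δ) := by
  have hc' : IsCompact (tsupport g) := hc
  obtain ⟨r0, hr0, hr0Ω⟩ := hc'.exists_cthickening_subset_open hΩ hs
  refine ⟨Metric.cthickening r0 (tsupport g), hr0Ω, hc'.cthickening,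
    Metric.self_subset_cthickening _, fun δ hδ => ?_⟩
  have hg1 : ContDiff ℝ 1 (fderiv ℝ g) := hg.fderiv_right (by norm_num)
  have hg2 : Continuous (fderiv ℝ (fderiv ℝ g)) := hg1.continuous_fderiv one_ne_zero
  have hc1 : HasCompactSupport (fderiv ℝ g) := hc.fderiv ℝ
  have hc2 : HasCompactSupport (fderiv ℝ (fderiv ℝ g)) := hc1.fderiv ℝ
  obtain ⟨r1, hr1, H1⟩ := moll_close (F := En n →L[ℝ] ℝ) (fderiv ℝ g) (hc1.uniformContinuous_of_continuous hg1.continuous) δ hδ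
  obtain ⟨r2, hr2, H2⟩ := moll_close (F := En n →L[ℝ] En n →L[ℝ] ℝ) (fderiv ℝ (fderiv ℝ g)) (hc2.uniformContinuous_of_continuous hg2) δ hδ
  obtain ⟨φ, h0, h1, h2⟩ : ∃ φ : ContDiffBump (0 : En n),
      φ.rOut ≤ r0 ∧ φ.rOut ≤ r1 ∧ φ.rOut ≤ r2 := by
    have hrpos : 0 < min r0 (min r1 r2) := lt_min hr0 (lt_min hr1 hr2)
    exact ⟨⟨min r0 (min r1 r2) / 2, min r0 (min r1 r2), by positivity, by linarith⟩,
      min_le_left _ _, (min_le_right _ _).trans (min_le_left _ _),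
      (min_le_right _ _).trans (min_le_right _ _)⟩
  have e1 := fderiv_moll φ g (hg.of_le (by norm_num)) hc
  have e2 := fderiv_moll φ (fderiv ℝ g) hg1 hc1
  have hsm : ContDiff ℝ (⊤ : ℕ∞)
      (φ.normed volume ⋆[ContinuousLinearMap.lsmul ℝ ℝ, volume] g) :=
    φ.hasCompactSupport_normed.contDiff_convolution_left (μ := (volume : Measure (En n)))
      (ContinuousLinearMap.lsmul ℝ ℝ) φ.contDiff_normed hg.continuous.locallyIntegrable
  refine ⟨(φ.normed volume ⋆[ContinuousLinearMap.lsmul ℝ ℝ, volume] g), hsm, ?_, ?_, ?_⟩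
  · apply closure_minimal _ Metric.isClosed_cthickening
    refine (support_convolution_subset _).trans ?_
    intro y hy
    obtain ⟨a, ha, b, hb, rfl⟩ := Set.mem_add.1 hy
    rw [φ.support_normed_eq] at ha
    apply Metric.mem_cthickening_of_dist_le _ b _ _ (subset_closure hb)
    simp only [Metric.mem_ball, dist_zero_right] at ha
    simp only [dist_eq_norm, add_sub_cancel_right]
    exact ha.le.trans h0
  · intro x
    rw [e1]
    exact H1 φ h1 x
  · intro x
    rw [e1, e2]
    exact H2 φ h2 x

theorem scalar_cutoff (a b : ℝ) (hab : a < b) : ∃ C ≥ 0, ∀ c d, b < c → c < d →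
    ∃ ψ χ : ℝ → ℝ, ContDiff ℝ 2 ψ ∧ ContDiff ℝ 1 χ ∧ (∀ t, HasDerivAt ψ (χ t) t) ∧
      (∀ t, d ≤ t → ψ t = 0) ∧
      (∀ t, 0 ≤ χ t) ∧ (∀ t ≤ a, χ t = 0) ∧ (∀ t, b ≤ t → t ≤ c → χ t = 1) ∧
      (∀ t, deriv χ t ≤ C) ∧ (∀ t, b < t → deriv χ t ≤ 0) := by
  let S : ℝ → ℝ := fun t => Real.smoothTransition ((t - a) / (b - a))
  have hba : 0 < b - a := by linarith
  have hS : ContDiff ℝ 1 S := (Real.smoothTransition.contDiff (n := 1)).comp (by fun_prop)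
  have hSd : Continuous (deriv S) := hS.continuous_deriv le_rfl
  have hS0 : ∀ t ≤ a, S t = 0 := fun t ht => Real.smoothTransition.zero_of_nonpos
    (div_nonpos_of_nonpos_of_nonneg (by linarith) hba.le)
  have hS1 : ∀ t, b ≤ t → S t = 1 := fun t ht => Real.smoothTransition.one_of_one_le
    (by rw [le_div_iff₀ hba]; linarith)
  have hSd1 : ∀ t, b < t → deriv S t = 0 := by
    intro t ht
    have : S =ᶠ[𝓝 t] fun _ => 1 := by
      filter_upwards [Ioi_mem_nhds ht] with s hs using hS1 s (le_of_lt hs)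
    rw [this.deriv_eq]; simp
  have hSd0 : ∀ t, t < a → deriv S t = 0 := by
    intro t ht
    have : S =ᶠ[𝓝 t] fun _ => 0 := by
      filter_upwards [Iio_mem_nhds ht] with s hs using hS0 s (le_of_lt hs)
    rw [this.deriv_eq]; simp
  obtain ⟨C, hC⟩ := (isCompact_Icc (a := a) (b := b)).exists_bound_of_continuousOn hSd.continuousOn
  have hC0 : 0 ≤ C := (norm_nonneg _).trans (hC a ⟨le_rfl, hab.le⟩)
  have hSC : ∀ t, |deriv S t| ≤ C := by
    intro t
    rcases lt_or_ge t a with h | h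
    · rw [hSd0 t h]; simpa
    rcases lt_or_ge b t with h' | h'
    · rw [hSd1 t h']; simpa
    exact hC t ⟨h, h'⟩
  refine ⟨C, hC0, fun c d hbc hcd => ?_⟩
  have hdc : 0 < d - c := by linarith
  let T : ℝ → ℝ := fun t => Real.smoothTransition ((d - t) / (d - c))
  have hT : ContDiff ℝ 1 T := (Real.smoothTransition.contDiff (n := 1)).comp (by fun_prop)
  have hTa : Antitone T := fun s t hst => Real.smoothTransition.monotone (by gcongr)
  have hT1 : ∀ t ≤ c, T t = 1 := fun t ht => Real.smoothTransition.one_of_one_le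
    (by rw [le_div_iff₀ hdc]; linarith)
  have hT0 : ∀ t, d ≤ t → T t = 0 := fun t ht => Real.smoothTransition.zero_of_nonpos
    (div_nonpos_of_nonpos_of_nonneg (by linarith) hdc.le)
  have hTd : ∀ t, deriv T t ≤ 0 := fun t => hTa.deriv_nonpos
  let χ : ℝ → ℝ := fun t => S t * T t
  have hχ : ContDiff ℝ 1 χ := hS.mul hT
  have hχd : ∀ t, deriv χ t = deriv S t * T t + S t * deriv T t := fun t =>
    deriv_fun_mul (hS.differentiable one_ne_zero t) (hT.differentiable one_ne_zero t)
  have hSn : ∀ t, 0 ≤ S t := fun t => Real.smoothTransition.nonneg _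
  have hTn : ∀ t, 0 ≤ T t := fun t => Real.smoothTransition.nonneg _
  have hTl : ∀ t, T t ≤ 1 := fun t => Real.smoothTransition.le_one _
  have hψ : ∀ t, HasDerivAt (fun t => ∫ s in d..t, χ s) (χ t) t := fun t =>
    intervalIntegral.integral_hasDerivAt_right (hχ.continuous.intervalIntegrable _ _)
      (hχ.continuous.stronglyMeasurableAtFilter _ _) hχ.continuous.continuousAt
  refine ⟨fun t => ∫ s in d..t, χ s, χ, ?_, hχ, hψ, ?_, ?_, ?_, ?_, ?_, ?_⟩
  · rw [show (2 : WithTop ℕ∞) = 1 + 1 by norm_num, contDiff_succ_iff_deriv]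
    refine ⟨fun t => (hψ t).differentiableAt, by simp, ?_⟩
    rw [show deriv (fun t => ∫ s in d..t, χ s) = χ from funext fun t => (hψ t).deriv]
    exact hχ
  · intro t ht
    apply intervalIntegral.integral_zero_ae
    refine Eventually.of_forall fun s hs => ?_
    rw [uIoc_of_le ht] at hs
    simp [χ, hT0 s hs.1.le]
  · intro t; exact mul_nonneg (hSn t) (hTn t)
  · intro t ht; simp [χ, hS0 t ht]
  · intro t h1 h2; simp [χ, hS1 t h1, hT1 t h2]
  · intro t
    rw [hχd]
    have h1 := mul_nonpos_of_nonneg_of_nonpos (hSn t) (hTd t)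
    have h2 : deriv S t * T t ≤ |deriv S t| * 1 :=
      (mul_le_mul_of_nonneg_right (le_abs_self _) (hTn t)).trans
        (mul_le_mul_of_nonneg_left (hTl t) (abs_nonneg _))
    linarith [hSC t]
  · intro t ht
    rw [hχd, hSd1 t ht]
    have h1 := mul_nonpos_of_nonneg_of_nonpos (hSn t) (hTd t)
    linarith

theorem prok {n : ℕ} (Ω : Set (En n)) (hΩ : IsOpen Ω) (μs : ℕ → Measure (En n))
    (hμ : ∀ k, IsProbOn Ω (μs k))
    (ht : ∀ ε > 0, ∃ K : Set (En n), IsCompact K ∧ K ⊆ Ω ∧ ∀ k, μs k (Ω \ K) < ENNReal.ofReal ε) :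
    ∃ t : ℕ → ℕ, StrictMono t ∧ ∃ μ : Measure (En n),
      IsProbOn Ω μ ∧ WeakStarLimOn Ω (fun m => μs (t m)) μ := by
  have hm : MeasurableSet Ω := hΩ.measurableSet
  have hemb : MeasurableEmbedding (Subtype.val : Ω → En n) := MeasurableEmbedding.subtype_coe hm
  have hp : ∀ k, IsProbabilityMeasure ((μs k).comap (Subtype.val : Ω → En n)) := by
    intro k
    have := (hμ k).1
    constructor
    rw [hemb.comap_apply, image_univ, Subtype.range_coe]
    exact (prob_compl_eq_zero_iff hm).1 (hμ k).2
  let ν : ℕ → ProbabilityMeasure Ω := fun k => ⟨(μs k).comap Subtype.val, hp k⟩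
  have htight : IsTightMeasureSet {((μ : ProbabilityMeasure Ω) : Measure Ω) | μ ∈ range ν} := by
    rw [isTightMeasureSet_iff_exists_isCompact_measure_compl_le]
    intro ε hε
    obtain ⟨e, he, hee⟩ : ∃ e : ℝ, 0 < e ∧ ENNReal.ofReal e ≤ ε := by
      rcases eq_or_ne ε ⊤ with rfl | h
      · exact ⟨1, one_pos, le_top⟩
      · exact ⟨ε.toReal, ENNReal.toReal_pos hε.ne' h, (ENNReal.ofReal_toReal h).le⟩
    obtain ⟨K, hK, hKΩ, H⟩ := ht e he
    refine ⟨Subtype.val ⁻¹' K, ?_, ?_⟩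
    · rw [Subtype.isCompact_iff, Subtype.image_preimage_coe, inter_eq_self_of_subset_right hKΩ]
      exact hK
    · rintro _ ⟨_, ⟨k, rfl⟩, rfl⟩
      change (μs k).comap Subtype.val _ ≤ ε
      rw [hemb.comap_apply, ← preimage_compl, Subtype.image_preimage_coe]
      exact (H k).le.trans hee
  have hcomp := isCompact_closure_of_isTightMeasureSet htight
  obtain ⟨ν', -, t, ht, hlim⟩ := hcomp.isSeqCompact (x := ν) (fun k => subset_closure ⟨k, rfl⟩)
  refine ⟨t, ht, (ν' : Measure Ω).map Subtype.val, ⟨?_, ?_⟩, ?_⟩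
  · exact Measure.isProbabilityMeasure_map hemb.measurable.aemeasurable
  · rw [hemb.map_apply]; simp
  · intro f hf ⟨C, hC⟩
    let g : BoundedContinuousFunction Ω ℝ := BoundedContinuousFunction.ofNormedAddCommGroup
      (Ω.domRestrict f) hf.domRestrict C (fun x => hC x x.2)
    have h := (ProbabilityMeasure.tendsto_iff_forall_integral_tendsto.1 hlim) g
    have e2 : ∫ x in Ω, f x ∂((ν' : Measure Ω).map Subtype.val) = ∫ x, g x ∂(ν' : Measure Ω) := by
      rw [hemb.setIntegral_map]; simp; rfl
    rw [e2]
    refine h.congr fun m => ?_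
    change ∫ x : Ω, f x ∂((μs (t m)).comap Subtype.val) = _
    exact integral_subtype_comap hm f

theorem adjFP_eq {n : ℕ} (A : En n → Matrix (Fin n) (Fin n) ℝ) (V : En n → En n)
    (f : En n → ℝ) (x : En n) : adjFP A V f x =
    (∑ i, ∑ j, A x i j * fderiv ℝ (fderiv ℝ f) x (EuclideanSpace.single i (1 : ℝ))
      (EuclideanSpace.single j (1 : ℝ))) + fderiv ℝ f x (V x) := by
  simp [adjFP, iteratedFDeriv_two_apply]

theorem adjFP_zero {n : ℕ} (A : En n → Matrix (Fin n) (Fin n) ℝ) (V : En n → En n)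
    (f : En n → ℝ) (x : En n) (hx : x ∉ tsupport f) : adjFP A V f x = 0 := by
  have h1 : x ∉ tsupport (fderiv ℝ f) := fun h => hx (tsupport_fderiv_subset ℝ h)
  have h2 : x ∉ tsupport (fderiv ℝ (fderiv ℝ f)) := fun h => h1 (tsupport_fderiv_subset ℝ h)
  rw [adjFP_eq, image_eq_zero_of_notMem_tsupport h1, image_eq_zero_of_notMem_tsupport h2]
  simp

theorem adjFP_cont {n : ℕ} (Ω : Set (En n)) (A : En n → Matrix (Fin n) (Fin n) ℝ)
    (V : En n → En n) (hA : ContinuousOn A Ω) (hV : ContinuousOn V Ω)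
    (g : En n → ℝ) (hg : ContDiff ℝ 2 g) : ContinuousOn (adjFP A V g) Ω := by
  have hg1 : ContDiff ℝ 1 (fderiv ℝ g) := hg.fderiv_right (by norm_num)
  have hg2 : Continuous (fderiv ℝ (fderiv ℝ g)) := hg1.continuous_fderiv one_ne_zero
  have : adjFP A V g = fun x => (∑ i, ∑ j, A x i j *
      fderiv ℝ (fderiv ℝ g) x (EuclideanSpace.single i (1 : ℝ))
      (EuclideanSpace.single j (1 : ℝ))) + fderiv ℝ g x (V x) := funext (adjFP_eq A V g)
  rw [this]
  refine ContinuousOn.add ?_ (hg1.continuous.continuousOn.clm_apply hV)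
  refine continuousOn_finsetSum _ fun i _ => continuousOn_finsetSum _ fun j _ => ?_
  refine ContinuousOn.mul ?_ ?_
  · exact (continuous_apply_apply i j).comp_continuousOn hA
  · exact ((hg2.clm_apply continuous_const).clm_apply continuous_const).continuousOn

theorem adjFP_int {n : ℕ} (Ω : Set (En n)) (hΩ : IsOpen Ω) (A : En n → Matrix (Fin n) (Fin n) ℝ)
    (V : En n → En n) (hA : ContinuousOn A Ω) (hV : ContinuousOn V Ω)
    (g : En n → ℝ) (hg : ContDiff ℝ 2 g) (hc : HasCompactSupport g) (hs : tsupport g ⊆ Ω)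
    (μ : Measure (En n)) [IsProbabilityMeasure μ] : IntegrableOn (adjFP A V g) Ω μ := by
  have h := adjFP_cont Ω A V hA hV g hg
  obtain ⟨M, hM⟩ := IsCompact.exists_bound_of_continuousOn (s := tsupport g) hc (h.mono hs)
  refine Integrable.of_bound (h.aestronglyMeasurable hΩ.measurableSet) (max M 0) ?_
  refine Eventually.of_forall fun x => ?_
  by_cases hx : x ∈ tsupport g
  · exact (hM x hx).trans (le_max_left _ _)
  · rw [adjFP_zero A V g x hx]; simp

theorem stat_C2 {n : ℕ} (Ω : Set (En n)) (hΩ : IsOpen Ω) (A : En n → Matrix (Fin n) (Fin n) ℝ)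
    (V : En n → En n) (hA : ContinuousOn A Ω) (hV : ContinuousOn V Ω)
    (g : En n → ℝ) (hg : ContDiff ℝ 2 g) (hc : HasCompactSupport g) (hs : tsupport g ⊆ Ω)
    (μ : Measure (En n)) (hμ : IsStationaryMeasure A V Ω μ) : ∫ x in Ω, adjFP A V g x ∂μ = 0 := by
  have := hμ.1.1
  obtain ⟨K, hKΩ, hK, hgK, H⟩ := smooth_approx g hg hc Ω hΩ hs
  have hcont : ContinuousOn (fun x => (∑ i, ∑ j, |A x i j|) + ‖V x‖) Ω := by
    refine ContinuousOn.add ?_ hV.norm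
    refine continuousOn_finsetSum _ fun i _ => continuousOn_finsetSum _ fun j _ => ?_
    exact ((continuous_apply_apply i j).comp_continuousOn hA).abs
  obtain ⟨B, hB⟩ := hK.exists_bound_of_continuousOn (hcont.mono hKΩ)
  have key : ∀ δ > 0, |∫ x in Ω, adjFP A V g x ∂μ| ≤ δ * max B 0 := by
    intro δ hδ
    obtain ⟨f, hf, hfK, h1, h2⟩ := H δ hδ
    have hfc : HasCompactSupport f := hK.of_isClosed_subset (isClosed_tsupport f) hfK
    have hf0 := hμ.2 f hf hfc (hfK.trans hKΩ)
    have hf2 : ContDiff ℝ 2 f := contDiff_infty.1 hf 2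
    have i1 := adjFP_int Ω hΩ A V hA hV g hg hc hs μ
    have i2 := adjFP_int Ω hΩ A V hA hV f hf2 hfc (hfK.trans hKΩ) μ
    have e : ∫ x in Ω, adjFP A V g x ∂μ = -∫ x in Ω, (adjFP A V f x - adjFP A V g x) ∂μ := by
      rw [integral_sub i2 i1, hf0]; ring
    rw [e, abs_neg]
    have hb : ∀ x ∈ Ω, ‖adjFP A V f x - adjFP A V g x‖ ≤ δ * max B 0 := by
      intro x hx
      by_cases hxK : x ∈ K
      · have e : adjFP A V f x - adjFP A V g x = (∑ i, ∑ j, A x i j *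
            (fderiv ℝ (fderiv ℝ f) x - fderiv ℝ (fderiv ℝ g) x) (EuclideanSpace.single i (1 : ℝ))
            (EuclideanSpace.single j (1 : ℝ))) + (fderiv ℝ f x - fderiv ℝ g x) (V x) := by
          rw [adjFP_eq, adjFP_eq]
          simp only [sub_apply, mul_sub, Finset.sum_sub_distrib]
          ring
        rw [e]
        have hd : ‖(fderiv ℝ f x - fderiv ℝ g x) (V x)‖ ≤ δ * ‖V x‖ :=
          ContinuousLinearMap.le_of_opNorm_le _ (h1 x) _
        have hs : ‖∑ i, ∑ j, A x i j *
            (fderiv ℝ (fderiv ℝ f) x - fderiv ℝ (fderiv ℝ g) x) (EuclideanSpace.single i (1 : ℝ))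
            (EuclideanSpace.single j (1 : ℝ))‖ ≤ ∑ i, ∑ j, |A x i j| * δ := by
          refine (norm_sum_le _ _).trans (Finset.sum_le_sum fun i _ => ?_)
          refine (norm_sum_le _ _).trans (Finset.sum_le_sum fun j _ => ?_)
          rw [norm_mul, Real.norm_eq_abs]
          refine mul_le_mul_of_nonneg_left ?_ (abs_nonneg _)
          have a1 := ContinuousLinearMap.le_opNorm₂
            (fderiv ℝ (fderiv ℝ f) x - fderiv ℝ (fderiv ℝ g) x) (EuclideanSpace.single i (1 : ℝ))
            (EuclideanSpace.single j (1 : ℝ))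
          simp only [PiLp.norm_single, norm_one, mul_one] at a1
          exact a1.trans (h2 x)
        have hB' := (le_abs_self _).trans (hB x hxK)
        have hB'' := mul_le_mul_of_nonneg_left (hB'.trans (le_max_left B 0)) hδ.le
        simp only [← Finset.sum_mul] at hs
        refine (norm_add_le _ _).trans ?_
        refine (add_le_add hs hd).trans (le_trans (le_of_eq ?_) hB'')
        ring
      · rw [adjFP_zero A V f x (fun h => hxK (hfK h)), adjFP_zero A V g x (fun h => hxK (hgK h))]
        simp only [sub_self, norm_zero]; positivity
    have := norm_setIntegral_le_of_norm_le_const (measure_lt_top μ Ω) hb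
    rw [Real.norm_eq_abs] at this
    refine this.trans ?_
    exact mul_le_of_le_one_right (by positivity) measureReal_le_one
  by_contra hne
  have hpos := abs_pos.2 hne
  set I := |∫ x in Ω, adjFP A V g x ∂μ|
  have hM : 0 < max B 0 + 1 := by positivity
  have := key (I / (max B 0 + 1)) (by positivity)
  have h3 : I / (max B 0 + 1) * max B 0 < I := by
    rw [div_mul_eq_mul_div, div_lt_iff₀ hM]; nlinarith
  linarith

theorem adjFP_comp {n : ℕ} (Ω : Set (En n)) (hΩ : IsOpen Ω) (A : En n → Matrix (Fin n) (Fin n) ℝ)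
    (V : En n → En n) (U : En n → ℝ) (hU : ContDiffOn ℝ 2 U Ω) (ψ χ : ℝ → ℝ)
    (hχ : ContDiff ℝ 1 χ) (hψ : ∀ t, HasDerivAt ψ (χ t) t) (g : En n → ℝ)
    (hg : ∀ x ∈ Ω, g x = ψ (U x)) (x : En n) (hx : x ∈ Ω) :
    adjFP A V g x = χ (U x) * adjFP A V U x + deriv χ (U x) *
      ∑ i, ∑ j, A x i j * (fderiv ℝ U x (EuclideanSpace.single i (1 : ℝ)) *
        fderiv ℝ U x (EuclideanSpace.single j (1 : ℝ))) := by
  have hUat : ∀ y ∈ Ω, DifferentiableAt ℝ U y := fun y hy =>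
    (hU.contDiffAt (hΩ.mem_nhds hy)).differentiableAt (by norm_num)
  have h1 : ∀ y ∈ Ω, fderiv ℝ g y = χ (U y) • fderiv ℝ U y := by
    intro y hy
    have he : g =ᶠ[𝓝 y] ψ ∘ U := by
      filter_upwards [hΩ.mem_nhds hy] with z hz using hg z hz
    rw [he.fderiv_eq]
    exact ((hψ (U y)).comp_hasFDerivAt y (hUat y hy).hasFDerivAt).fderiv
  have hU2 : DifferentiableAt ℝ (fderiv ℝ U) x :=
    ((hU.contDiffAt (hΩ.mem_nhds hx)).fderiv_right (m := 1) (by norm_num)).differentiableAt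
      (by norm_num)
  have h2 : fderiv ℝ (fderiv ℝ g) x = χ (U x) • fderiv ℝ (fderiv ℝ U) x +
      (deriv χ (U x) • fderiv ℝ U x).smulRight (fderiv ℝ U x) := by
    have he : fderiv ℝ g =ᶠ[𝓝 x] fun y => χ (U y) • fderiv ℝ U y := by
      filter_upwards [hΩ.mem_nhds hx] with z hz using h1 z hz
    rw [he.fderiv_eq]
    have hc : HasFDerivAt (fun y => χ (U y)) (deriv χ (U x) • fderiv ℝ U x) x :=
      ((hχ.differentiable one_ne_zero (U x)).hasDerivAt.comp_hasFDerivAt x (hUat x hx).hasFDerivAt)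
    exact (hc.smul hU2.hasFDerivAt).fderiv
  rw [adjFP_eq, adjFP_eq, h1 x hx, h2]
  simp only [add_apply, smul_apply,
    ContinuousLinearMap.smulRight_apply, smul_eq_mul, mul_add, Finset.sum_add_distrib,
    Finset.mul_sum]
  have e1 : ∀ i j, A x i j * (χ (U x) * fderiv ℝ (fderiv ℝ U) x (EuclideanSpace.single i (1 : ℝ))
      (EuclideanSpace.single j (1 : ℝ))) = χ (U x) * (A x i j *
      fderiv ℝ (fderiv ℝ U) x (EuclideanSpace.single i (1 : ℝ))
      (EuclideanSpace.single j (1 : ℝ))) := fun i j => by ring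
  have e2 : ∀ i j, A x i j * (deriv χ (U x) * fderiv ℝ U x (EuclideanSpace.single i (1 : ℝ)) *
      fderiv ℝ U x (EuclideanSpace.single j (1 : ℝ))) = deriv χ (U x) * (A x i j *
      (fderiv ℝ U x (EuclideanSpace.single i (1 : ℝ)) *
      fderiv ℝ U x (EuclideanSpace.single j (1 : ℝ)))) := fun i j => by ring
  simp only [e1, e2]
  ring

theorem level_est {n : ℕ} (Ω : Set (En n)) (hΩ : IsOpen Ω) (A : En n → Matrix (Fin n) (Fin n) ℝ)
    (V : En n → En n) (hA : ContinuousOn A Ω) (hV : ContinuousOn V Ω)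
    (hpd : ∀ x ∈ Ω, (A x).PosDef)
    (U : En n → ℝ) (hU : ContDiffOn ℝ 2 U Ω) (a b c d γ C η : ℝ) (hγ : 0 < γ) (hC : 0 ≤ C)
    (hη : 0 ≤ η)
    (hK : IsCompact {x ∈ Ω | U x ≤ d})
    (hL : ∀ x ∈ Ω, a < U x → adjFP A V U x ≤ -γ)
    (hQ : ∀ x ∈ Ω, U x ≤ b → ∑ i, ∑ j, A x i j * (fderiv ℝ U x (EuclideanSpace.single i (1 : ℝ)) *
        fderiv ℝ U x (EuclideanSpace.single j (1 : ℝ))) ≤ η)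
    (ψ χ : ℝ → ℝ) (hψ2 : ContDiff ℝ 2 ψ) (hχ : ContDiff ℝ 1 χ) (hψ : ∀ t, HasDerivAt ψ (χ t) t)
    (h1 : ∀ t, d ≤ t → ψ t = 0)
    (h2 : ∀ t, 0 ≤ χ t) (h3 : ∀ t ≤ a, χ t = 0) (h4 : ∀ t, b ≤ t → t ≤ c → χ t = 1)
    (h5 : ∀ t, deriv χ t ≤ C) (h6 : ∀ t, b < t → deriv χ t ≤ 0)
    (μ : Measure (En n)) (hμ : IsStationaryMeasure A V Ω μ) :
    γ * μ.real {x ∈ Ω | b ≤ U x ∧ U x ≤ c} ≤ C * η := by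
  classical
  have := hμ.1.1
  let g : En n → ℝ := Ω.indicator (fun x => ψ (U x))
  have hgΩ : ∀ x ∈ Ω, g x = ψ (U x) := fun x hx => indicator_of_mem hx _
  set K := {x ∈ Ω | U x ≤ d} with hKdef
  have hKΩ : K ⊆ Ω := fun x hx => hx.1
  have hg0 : ∀ x ∉ K, g x = 0 := by
    intro x hx
    by_cases hxΩ : x ∈ Ω
    · rw [hgΩ x hxΩ]
      apply h1
      by_contra hlt
      exact hx ⟨hxΩ, (not_le.1 hlt).le⟩
    · exact indicator_of_notMem hxΩ _
  have hgs : tsupport g ⊆ K := by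
    apply closure_minimal _ hK.isClosed
    intro x hx
    by_contra hxK
    exact hx (hg0 x hxK)
  have hgc : HasCompactSupport g := hK.of_isClosed_subset (isClosed_tsupport g) hgs
  have hg : ContDiff ℝ 2 g := by
    rw [contDiff_iff_contDiffAt]
    intro x
    by_cases hxΩ : x ∈ Ω
    · have he : g =ᶠ[𝓝 x] ψ ∘ U := by
        filter_upwards [hΩ.mem_nhds hxΩ] with z hz using hgΩ z hz
      exact (hψ2.contDiffAt.comp x (hU.contDiffAt (hΩ.mem_nhds hxΩ))).congr_of_eventuallyEq he
    · have he : g =ᶠ[𝓝 x] fun _ => 0 := by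
        filter_upwards [hK.isClosed.isOpen_compl.mem_nhds (fun h => hxΩ (hKΩ h))] with z hz
          using hg0 z hz
      exact contDiffAt_const.congr_of_eventuallyEq he
  have hint := adjFP_int Ω hΩ A V hA hV g hg hgc (hgs.trans hKΩ) μ
  have hz := stat_C2 Ω hΩ A V hA hV g hg hgc (hgs.trans hKΩ) μ hμ
  set S := {x ∈ Ω | b ≤ U x ∧ U x ≤ c} with hS
  have hSm : MeasurableSet S := by
    obtain ⟨O, hO, hOe⟩ := (continuousOn_iff_isClosed.1 hU.continuousOn) (Icc b c) isClosed_Icc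
    have : S = O ∩ Ω := by
      rw [← hOe]; ext x; simp only [hS, mem_ofPred_eq, mem_inter_iff, mem_preimage, mem_Icc]; tauto
    rw [this]
    exact hO.measurableSet.inter hΩ.measurableSet
  have hpt : ∀ x ∈ Ω, adjFP A V g x ≤ S.indicator (fun _ => -γ) x + C * η := by
    intro x hx
    rw [adjFP_comp Ω hΩ A V U hU ψ χ hχ hψ g hgΩ x hx]
    set Q := ∑ i, ∑ j, A x i j * (fderiv ℝ U x (EuclideanSpace.single i (1 : ℝ)) *
        fderiv ℝ U x (EuclideanSpace.single j (1 : ℝ))) with hQdef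
    have hQ0 : 0 ≤ Q := by
      have := (hpd x hx).posSemidef.dotProduct_mulVec_nonneg
        (fun i => fderiv ℝ U x (EuclideanSpace.single i (1 : ℝ)))
      refine this.trans (le_of_eq ?_)
      simp only [dotProduct, Matrix.mulVec, Finset.mul_sum, hQdef, Pi.star_apply, star_trivial]
      refine Finset.sum_congr rfl fun i _ => Finset.sum_congr rfl fun j _ => by ring
    have p1 : χ (U x) * adjFP A V U x ≤ S.indicator (fun _ => -γ) x := by
      have q1 : χ (U x) * adjFP A V U x ≤ χ (U x) * (-γ) := by
        rcases le_or_gt (U x) a with h | h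
        · rw [h3 _ h]; simp
        · exact mul_le_mul_of_nonneg_left (hL x hx h) (h2 _)
      refine q1.trans ?_
      by_cases hxS : x ∈ S
      · rw [indicator_of_mem hxS, h4 _ hxS.2.1 hxS.2.2, one_mul]
      · rw [indicator_of_notMem hxS]
        have := mul_nonneg (h2 (U x)) hγ.le
        linarith
    have p2 : deriv χ (U x) * Q ≤ C * η := by
      rcases le_or_gt (U x) b with h | h
      · exact (mul_le_mul_of_nonneg_right (h5 _) hQ0).trans
          (mul_le_mul_of_nonneg_left (hQ x hx h) hC)
      · exact (mul_nonpos_of_nonpos_of_nonneg (h6 _ h) hQ0).trans (mul_nonneg hC hη)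
    exact add_le_add p1 p2
  have hi1 : IntegrableOn (S.indicator (fun _ => -γ)) Ω μ :=
    (integrable_const (-γ)).indicator hSm
  have hi2 : IntegrableOn (fun _ : En n => C * η) Ω μ := integrable_const (C * η)
  have hle := setIntegral_mono_on hint (hi1.add hi2) hΩ.measurableSet hpt
  have hΩ1 : μ.real Ω = 1 := by
    have := (prob_compl_eq_zero_iff hΩ.measurableSet).1 hμ.1.2
    simp [Measure.real, this]
  have hSΩ : S ⊆ Ω := fun x hx => hx.1
  have e : ∫ x in Ω, (S.indicator (fun _ => -γ) x + C * η) ∂μ = -(γ * μ.real S) + C * η := by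
    rw [integral_add hi1 hi2, setIntegral_indicator hSm, setIntegral_const, setIntegral_const,
      inter_eq_self_of_subset_right hSΩ, hΩ1]
    simp only [smul_eq_mul]; ring
  rw [hz] at hle
  have hle' : 0 ≤ ∫ x in Ω, (S.indicator (fun _ => -γ) x + C * η) ∂μ := hle
  rw [e] at hle'
  linarith

/-- Let `Ω ⊆ 𝒰` be a connected open set, `(A_k)` a null sequence of diffusion
matrices on `𝒰` admitting a uniform Lyapunov function `U` on `Ω`, and for each `k` let `μ_k`
be a stationary measure for `ℒ_{A_k}` on `Ω`. Then the family `{μ_k}` is tight and hence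
relatively sequentially compact in the weak* topology. -/
theorem stmt8 {n : ℕ} (hn : 1 ≤ n) (𝒰 Ω : Set (En n))
    (h𝒰open : IsOpen 𝒰) (h𝒰conn : IsConnected 𝒰)
    (V : En n → En n) (hV : ContinuousOn V 𝒰)
    (hΩopen : IsOpen Ω) (hΩconn : IsConnected Ω) (hΩ𝒰 : Ω ⊆ 𝒰)
    (A : ℕ → En n → Matrix (Fin n) (Fin n) ℝ) (hA : IsNullSeq 𝒰 A)
    (U : En n → ℝ) (ρm γ : ℝ) (hU : IsUniformLyap A V Ω U ρm γ)
    (μs : ℕ → Measure (En n)) (hμs : ∀ k, IsStationaryMeasure (A k) V Ω (μs k)) :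
    (∀ ε > 0, ∃ K : Set (En n), IsCompact K ∧ K ⊆ Ω ∧ ∀ k, μs k (Ω \ K) < ENNReal.ofReal ε) ∧
    (∀ s : ℕ → ℕ, StrictMono s → ∃ t : ℕ → ℕ, StrictMono t ∧ ∃ μ : Measure (En n),
      IsProbOn Ω μ ∧ WeakStarLimOn Ω (fun m => μs (s (t m))) μ) := by
  have tight : ∀ ε > 0, ∃ K : Set (En n), IsCompact K ∧ K ⊆ Ω ∧
      ∀ k, μs k (Ω \ K) < ENNReal.ofReal ε := by
    intro ε hε
    obtain ⟨hUd, ⟨hUc, hU0, hUM, hUK⟩, hρm, hρM, hγ, hL⟩ := hU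
    obtain ⟨hAc, hApd, hA0⟩ := hA
    obtain ⟨b, hab, hbM⟩ := EReal.lt_iff_exists_real_btwn.1 hρM
    have hab' : ρm < b := EReal.coe_lt_coe_iff.1 hab
    obtain ⟨b', hbb, hb'M⟩ := EReal.lt_iff_exists_real_btwn.1 hbM
    have hbb' : b < b' := EReal.coe_lt_coe_iff.1 hbb
    obtain ⟨C, hC, hcut⟩ := scalar_cutoff ρm b hab'
    have hK1 := hUK b hbM
    set K1 := {x ∈ Ω | U x ≤ b} with hK1def
    have hK1Ω : K1 ⊆ Ω := fun x hx => hx.1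
    have hdc : ContinuousOn (fderiv ℝ U) K1 :=
      (hUd.continuousOn_fderiv_of_isOpen hΩopen (by norm_num)).mono hK1Ω
    obtain ⟨D, hD⟩ := hK1.exists_bound_of_continuousOn hdc
    have hsm : ∀ k, ∃ Kk ⊆ Ω, IsCompact Kk ∧ μs k (Ω \ Kk) < ENNReal.ofReal (ε / 2) := by
      intro k
      have := (hμs k).1.1
      exact hΩopen.measurableSet.exists_isCompact_sdiff_lt (measure_ne_top _ _)
        (ENNReal.ofReal_pos.2 (by linarith)).ne'
    set M : ℝ := C * ((n : ℝ) * n * (D * D)) + 1 with hM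
    have hMpos : 0 < M := by
      have : 0 ≤ D * D := mul_self_nonneg D
      positivity
    set e : ℝ := γ * (ε / 4) / M with he
    have hepos : 0 < e := by positivity
    obtain ⟨N, hN⟩ := hA0 K1 (hK1Ω.trans hΩ𝒰) hK1 e hepos
    have htail : ∀ k ≥ N, μs k (Ω \ K1) < ENNReal.ofReal ε := by
      intro k hk
      have := (hμs k).1.1
      obtain ⟨Kk, hKkΩ, hKk, hμk⟩ := hsm k
      obtain ⟨c, hbc, hcM, hcK⟩ : ∃ c : ℝ, b < c ∧ (c : EReal) < ⨆ y ∈ Ω, (U y : EReal) ∧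
          ∀ x ∈ Kk, U x ≤ c := by
        rcases Kk.eq_empty_or_nonempty with h | h
        · exact ⟨b', hbb', hb'M, by simp [h]⟩
        · obtain ⟨x0, hx0, hmax⟩ := hKk.exists_isMaxOn h (hUc.mono hKkΩ)
          refine ⟨max b' (U x0), lt_max_of_lt_left hbb', ?_, fun x hx =>
            (hmax hx).trans (le_max_right _ _)⟩
          rcases max_choice b' (U x0) with h | h <;> rw [h]
          · exact hb'M
          · exact hUM x0 (hKkΩ hx0)
      obtain ⟨d, hcd, hdM⟩ := EReal.lt_iff_exists_real_btwn.1 hcM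
      have hcd' : c < d := EReal.coe_lt_coe_iff.1 hcd
      obtain ⟨ψ, χ, g1, g2, g3, g4, g5, g6, g7, g8, g9⟩ := hcut c d hbc hcd'
      have hη : 0 ≤ (n : ℝ) * n * (D * D) * e := by
        have : 0 ≤ D * D := mul_self_nonneg D
        positivity
      have hQ : ∀ x ∈ Ω, U x ≤ b → ∑ i, ∑ j, A k x i j *
          (fderiv ℝ U x (EuclideanSpace.single i (1 : ℝ)) *
          fderiv ℝ U x (EuclideanSpace.single j (1 : ℝ))) ≤ (n : ℝ) * n * (D * D) * e := by
        intro x hx hxb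
        have hxK : x ∈ K1 := ⟨hx, hxb⟩
        have hDi : ∀ i, |fderiv ℝ U x (EuclideanSpace.single i (1 : ℝ))| ≤ D := by
          intro i
          have := ContinuousLinearMap.le_of_opNorm_le _ (hD x hxK) (EuclideanSpace.single i (1 : ℝ))
          simpa using this
        have hterm : ∀ i j, A k x i j *
          (fderiv ℝ U x (EuclideanSpace.single i (1 : ℝ)) *
          fderiv ℝ U x (EuclideanSpace.single j (1 : ℝ))) ≤ e * (D * D) := by
          intro i j
          refine (le_abs_self _).trans ?_
          rw [abs_mul, abs_mul]
          have hD0 : 0 ≤ D := (abs_nonneg _).trans (hDi i)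
          exact mul_le_mul (hN k hk x hxK i j)
            (mul_le_mul (hDi i) (hDi j) (abs_nonneg _) hD0) (by positivity) hepos.le
        refine (Finset.sum_le_sum fun i _ => Finset.sum_le_sum fun j _ => hterm i j).trans
          (le_of_eq ?_)
        simp only [Finset.sum_const, Finset.card_univ, Fintype.card_fin, nsmul_eq_mul]
        ring
      have hest := level_est Ω hΩopen (A k) V ((hAc k).mono hΩ𝒰) (hV.mono hΩ𝒰)
        (fun x hx => hApd k x (hΩ𝒰 hx)) U hUd ρm b c d γ C _ hγ hC hη (hUK d hdM) (hL k) hQ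
        ψ χ g1 g2 g3 g4 g5 g6 g7 g8 g9 (μs k) (hμs k)
      have hle : C * ((n : ℝ) * n * (D * D) * e) ≤ γ * (ε / 4) := by
        have h1 : M * e = γ * (ε / 4) := by rw [he]; field_simp
        rw [← h1, hM]; nlinarith
      have hSr : (μs k).real {x ∈ Ω | b ≤ U x ∧ U x ≤ c} ≤ ε / 4 :=
        le_of_mul_le_mul_left (hest.trans hle) hγ
      have hSe : μs k {x ∈ Ω | b ≤ U x ∧ U x ≤ c} ≤ ENNReal.ofReal (ε / 4) := by
        rw [← ofReal_measureReal (measure_ne_top _ _)]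
        exact ENNReal.ofReal_le_ofReal hSr
      have hsub : Ω \ K1 ⊆ (Ω \ Kk) ∪ {x ∈ Ω | b ≤ U x ∧ U x ≤ c} := by
        rintro x ⟨hx, hxK⟩
        by_cases hxk : x ∈ Kk
        · right
          refine ⟨hx, ?_, hcK x hxk⟩
          by_contra hlt
          exact hxK ⟨hx, (not_le.1 hlt).le⟩
        · exact Or.inl ⟨hx, hxk⟩
      calc μs k (Ω \ K1) ≤ μs k (Ω \ Kk) + μs k {x ∈ Ω | b ≤ U x ∧ U x ≤ c} :=
            (measure_mono hsub).trans (measure_union_le _ _)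
        _ < ENNReal.ofReal (ε / 2) + ENNReal.ofReal (ε / 2) := by
            refine ENNReal.add_lt_add hμk (hSe.trans_lt ?_)
            exact (ENNReal.ofReal_lt_ofReal_iff (by linarith)).2 (by linarith)
        _ = ENNReal.ofReal ε := by
            rw [← ENNReal.ofReal_add (by linarith) (by linarith)]; congr 1; ring
    choose Kf hKfΩ hKfc hKf using hsm
    refine ⟨K1 ∪ ⋃ k ∈ Finset.range N, Kf k, hK1.union
      ((Finset.range N).isCompact_biUnion fun k _ => hKfc k),
      union_subset hK1Ω (iUnion₂_subset fun k _ => hKfΩ k), fun k => ?_⟩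
    rcases lt_or_ge k N with hk | hk
    · refine (measure_mono (diff_subset_diff_right ?_)).trans_lt ((hKf k).trans_le
        (ENNReal.ofReal_le_ofReal (by linarith)))
      exact (subset_biUnion_of_mem (u := Kf) (Finset.mem_coe.2 (Finset.mem_range.2 hk))).trans
        subset_union_right
    · exact (measure_mono (diff_subset_diff_right subset_union_left)).trans_lt (htail k hk)
  refine ⟨tight, fun s _ => ?_⟩
  refine prok Ω hΩopen (fun m => μs (s m)) (fun m => (hμs (s m)).1) fun ε hε => ?_
  obtain ⟨K, h1, h2, h3⟩ := tight ε hε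
  exact ⟨K, h1, h2, fun k => h3 (s k)⟩

end
end
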